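/- Let a, b, c be integers with c > 0. Then the Kloosterman-type sum ∑'_{x mod c} e^{2πi(ax + b x̄)/c}, where the sum runs over x with gcd(x,c) = 1 and x̄ is the inverse of x modulo c, has absolute value at most C·c^{1/2}·d(c)·gcd(a,b,c)^{1/2} for an absolute constant C, where d(c) is the number of divisors of c. -/

import Mathlib

section KWPoly
open Polynomial


theorem kw_exists_place {F : Type*} [Field F] (p : ℕ) (hp : 1 < p) (b c : F) :
    ∃ v : Valuation (QuadraticAlgebra F[X] (-C b) (X ^ p - X + C c)) (WithZero (Multiplicative ℤ)),
      v QuadraticAlgebra.omega = WithZero.exp (p : ℤ) ∧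
      ∀ A : F[X], A ≠ 0 → v (algebraMap _ _ A) = WithZero.exp (A.natDegree : ℤ) := by
  classical
  set t : F[X] := X ^ p - X + C c with ht
  have htdeg : t.natDegree = p := by
    have h1 : (X ^ p : F[X]).natDegree = p := natDegree_X_pow p
    have h2 : (-X + C c : F[X]).natDegree < (X ^ p : F[X]).natDegree := by
      rw [h1]
      refine lt_of_le_of_lt (b := 1) ?_ hp
      compute_degree!
    have h3 : t = X ^ p + (-X + C c) := by rw [ht]; ring
    rw [h3, natDegree_add_eq_left_of_natDegree_lt h2, h1]
  have ht0 : t ≠ 0 := by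
    intro h; rw [h] at htdeg; simp at htdeg; omega
  let K := LaurentSeries F
  let v : Valuation K (WithZero (Multiplicative ℤ)) := Valued.v
  let y : K := HahnSeries.single (-1 : ℤ) (1 : F)
  have hvy : v y = WithZero.exp (1 : ℤ) := by
    have := LaurentSeries.valuation_single_zpow F (-1)
    simpa using this
  have htriv : v.IsTrivialOn F := by
    refine ⟨fun a ha => ?_⟩
    rw [LaurentSeries.algebraMap_apply]
    have h1 := LaurentSeries.valuation_le_iff_coeff_lt_eq_zero F (D := 0) (f := HahnSeries.C a)
    have h2 := LaurentSeries.valuation_le_iff_coeff_lt_eq_zero F (D := 0) (f := HahnSeries.C a⁻¹)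
    have h1' : v (HahnSeries.C a) ≤ 1 := by
      refine (h1.2 ?_).trans (by simp)
      intro n hn
      simp [HahnSeries.C_apply, HahnSeries.coeff_single_of_ne hn.ne]
    have h2' : v (HahnSeries.C a⁻¹) ≤ 1 := by
      refine (h2.2 ?_).trans (by simp)
      intro n hn
      simp [HahnSeries.C_apply, HahnSeries.coeff_single_of_ne hn.ne]
    rw [map_inv₀, map_inv₀] at h2'
    have hne : v (HahnSeries.C a) ≠ 0 := by
      rw [Valuation.ne_zero_iff]; exact (_root_.map_ne_zero _).2 ha
    refine le_antisymm h1' ?_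
    exact (inv_le_one₀ (zero_lt_iff.2 hne)).1 h2'
  have hpoly : ∀ A : F[X], A ≠ 0 → v (aeval y A) = WithZero.exp (A.natDegree : ℤ) := by
    intro A hA
    have := valuation_aeval_eq_valuation_X_pow_natDegree_of_one_lt_valuation_X (v := v) y
      (by rw [hvy]; rw [← WithZero.exp_zero]; exact WithZero.exp_lt_exp.2 one_pos) hA
    rw [this, hvy, ← WithZero.exp_nsmul]; simp
  set T : K := aeval y t with hT
  have hvT : v T = WithZero.exp (p : ℤ) := by rw [hT, hpoly t ht0, htdeg]
  have hT0 : T ≠ 0 := by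
    intro h; rw [h, map_zero] at hvT; exact WithZero.exp_ne_zero hvT.symm
  let u : K := HahnSeries.single (1 : ℤ) (1 : F)
  have huy : u * y = 1 := by
    have := HahnSeries.single_mul_single (Γ := ℤ) (R := F) (a := 1) (b := -1) (r := 1) (s := 1)
    refine this.trans ?_
    norm_num
  have hvb : v (algebraMap F K b) ≤ 1 := by
    by_cases hb : b = 0
    · simp [hb]
    · exact (htriv.eq_one b hb).le
  obtain ⟨s1, hs1⟩ : ∃ s1 : PowerSeries F, (s1 : K) = algebraMap F K b / T ^ 2 * y := by
    refine (LaurentSeries.val_le_one_iff_eq_coe F _).1 ?_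
    change v _ ≤ 1
    rw [map_mul, map_div₀, map_pow, hvT, hvy, ← WithZero.exp_nsmul]
    rw [div_eq_mul_inv, ← WithZero.exp_neg, mul_assoc, ← WithZero.exp_add]
    refine mul_le_one' hvb ?_
    rw [← WithZero.exp_zero]
    refine WithZero.exp_le_exp.2 ?_
    simp; omega
  have hs : ((PowerSeries.X * s1 : PowerSeries F) : K) = algebraMap F K b / T ^ 2 := by
    rw [PowerSeries.coe_mul, hs1, PowerSeries.coe_X]
    change u * _ = _
    linear_combination (algebraMap F K b / T ^ 2) * huy
  obtain ⟨Z, hZ, hZ1⟩ := HenselianRing.is_henselian (I := Ideal.span {(PowerSeries.X : PowerSeries F)})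
    (X ^ 2 - X + C (PowerSeries.X * s1)) (by monicity!) 1
    (by simp; exact Ideal.mul_mem_right _ _ (Ideal.mem_span_singleton_self _))
    (by simp)
  have hZ2 : Z ^ 2 - Z + PowerSeries.X * s1 = 0 := by simpa [IsRoot] using hZ
  have hZK : (Z : K) ^ 2 - (Z : K) + algebraMap F K b / T ^ 2 = 0 := by
    rw [← hs, ← PowerSeries.coe_pow, ← PowerSeries.coe_sub, ← PowerSeries.coe_add, hZ2, PowerSeries.coe_zero]
  have hvZ : v (Z : K) = 1 := by
    obtain ⟨w, hw⟩ := Ideal.mem_span_singleton.1 hZ1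
    have hw' : (Z : K) = 1 + u * (w : K) := by
      have : Z = 1 + PowerSeries.X * w := by rw [← hw]; ring
      rw [this, PowerSeries.coe_add, PowerSeries.coe_mul, PowerSeries.coe_X, PowerSeries.coe_one]
    have hvu : v u = WithZero.exp (-1 : ℤ) := by
      have := LaurentSeries.valuation_single_zpow F 1
      simpa using this
    have hvw : v (w : K) ≤ 1 := (LaurentSeries.val_le_one_iff_eq_coe F _).2 ⟨w, rfl⟩
    rw [hw']
    refine Valuation.map_one_add_of_lt _ ?_
    rw [map_mul, hvu]
    calc _ ≤ WithZero.exp (-1 : ℤ) * 1 := by gcongr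
      _ < 1 := by
        rw [mul_one, ← WithZero.exp_zero]; exact WithZero.exp_lt_exp.2 (by norm_num)
  let _ : Algebra F[X] K := (aeval y : F[X] →ₐ[F] K).toRingHom.toAlgebra
  have halg : ∀ A : F[X], algebraMap F[X] K A = aeval y A := fun A => rfl
  let φ : QuadraticAlgebra F[X] (-C b) t →ₐ[F[X]] K := QuadraticAlgebra.lift ⟨T * (Z : K), by
    rw [Algebra.smul_def, Algebra.smul_def, halg, halg, ← hT]
    simp only [map_neg, aeval_C, mul_one]
    field_simp at hZK
    linear_combination hZK⟩
  refine ⟨v.comap φ.toRingHom, ?_, ?_⟩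
  · have : φ QuadraticAlgebra.omega = T * (Z : K) := by
      simp [φ]
    rw [Valuation.comap_apply]
    change v (φ _) = _
    rw [this, map_mul, hvT, hvZ, mul_one]
  · intro A hA
    rw [Valuation.comap_apply]
    change v (φ _) = _
    rw [AlgHom.commutes, halg, hpoly A hA]

/-- The coordinate ring of the affine curve `y ^ p - y + c = x + b / x`. -/
abbrev KWRing {F : Type*} [Field F] (p : ℕ) (b c : F) : Type _ :=
  QuadraticAlgebra F[X] (-C b) (X ^ p - X + C c)

/-- functions with poles of order at most `l` at both places at infinity -/
def KWIn {F : Type*} [Field F] {p : ℕ} {b c : F} (l : ℕ) (f : KWRing p b c) : Prop :=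
  f.re.degree ≤ (l : WithBot ℕ) ∧ f.im.degree + (p : WithBot ℕ) ≤ (l : WithBot ℕ)

section Stepanov
variable {F : Type*} [Field F] {p : ℕ} {b c : F}

theorem kw_t_degree (hp : 1 < p) : (X ^ p - X + C c : F[X]).degree = p := by
  have h1 : (X ^ p : F[X]).degree = p := degree_X_pow p
  have h2 : (-X + C c : F[X]).degree < (X ^ p : F[X]).degree := by
    rw [h1]
    refine lt_of_le_of_lt (b := ((1 : ℕ) : WithBot ℕ)) ?_ (by exact_mod_cast hp)
    compute_degree!
  have h3 : (X ^ p - X + C c : F[X]) = X ^ p + (-X + C c) := by ring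
  rw [h3, degree_add_eq_left_of_degree_lt h2, h1]

theorem KWIn.mul (hp : 1 < p) {l m : ℕ} {f g : KWRing p b c} (hf : KWIn l f) (hg : KWIn m g) :
    KWIn (l + m) (f * g) := by
  obtain ⟨hf1, hf2⟩ := hf
  obtain ⟨hg1, hg2⟩ := hg
  have hp0 : (0 : WithBot ℕ) ≤ (p : WithBot ℕ) := by exact_mod_cast Nat.zero_le p
  have hfi : f.im.degree ≤ (l : WithBot ℕ) := le_trans (le_add_of_nonneg_right hp0) hf2
  have hgi : g.im.degree ≤ (m : WithBot ℕ) := le_trans (le_add_of_nonneg_right hp0) hg2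
  have key : ∀ {A B : F[X]} {i j : WithBot ℕ}, A.degree ≤ i → B.degree ≤ j →
      (A * B).degree ≤ i + j := fun hA hB => (degree_mul_le _ _).trans (add_le_add hA hB)
  have hb : (-C b : F[X]).degree ≤ 0 := by rw [degree_neg]; exact degree_C_le
  constructor
  · rw [QuadraticAlgebra.re_mul]
    push_cast
    refine (degree_add_le _ _).trans (max_le (key hf1 hg1) ?_)
    simpa using key (key hb hfi) hgi
  · rw [QuadraticAlgebra.im_mul]
    push_cast
    have e : ∀ {A B D : F[X]} {i : WithBot ℕ}, A.degree + p ≤ i → B.degree + p ≤ i →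
        D.degree + p ≤ i → (A + B + D).degree + p ≤ i := by
      intro A B D i hA hB hD
      have h0 := degree_add_le (A + B) D
      have h1 := degree_add_le A B
      rcases le_max_iff.1 h0 with h | h
      · rcases le_max_iff.1 h1 with h' | h'
        · exact (add_le_add_left (h.trans h') _).trans hA
        · exact (add_le_add_left (h.trans h') _).trans hB
      · exact (add_le_add_left h _).trans hD
    refine e ?_ ?_ ?_
    · rw [degree_mul, add_assoc]; exact add_le_add hf1 hg2
    · rw [degree_mul, add_right_comm]; exact add_le_add hf2 hg1
    · rw [degree_mul, degree_mul, kw_t_degree hp]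
      calc _ = (f.im.degree + p) + (g.im.degree + p) := by abel
        _ ≤ _ := add_le_add hf2 hg2

theorem KWIn.one : KWIn 0 (1 : KWRing p b c) := by
  constructor
  · simp [QuadraticAlgebra.re_one]
  · simp [QuadraticAlgebra.im_one]

theorem KWIn.mono {l m : ℕ} {f : KWRing p b c} (hf : KWIn l f) (h : l ≤ m) : KWIn m f :=
  ⟨hf.1.trans (by exact_mod_cast h), hf.2.trans (by exact_mod_cast h)⟩

theorem KWIn.pow (hp : 1 < p) {l : ℕ} {f : KWRing p b c} (hf : KWIn l f) (n : ℕ) :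
    KWIn (l * n) (f ^ n) := by
  induction n with
  | zero => simpa using KWIn.one
  | succ n ih => rw [pow_succ]; exact ih.mul hp hf

theorem KWIn.add {l : ℕ} {f g : KWRing p b c} (hf : KWIn l f) (hg : KWIn l g) : KWIn l (f + g) := by
  refine ⟨(degree_add_le _ _).trans (max_le hf.1 hg.1), ?_⟩
  rcases le_max_iff.1 (degree_add_le f.im g.im) with h | h
  · exact (add_le_add_left h _).trans hf.2
  · exact (add_le_add_left h _).trans hg.2

theorem KWIn.zero {l : ℕ} : KWIn l (0 : KWRing p b c) := by
  constructor <;> simp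

theorem KWIn.sum {ι : Type*} {l : ℕ} (s : Finset ι) (f : ι → KWRing p b c)
    (h : ∀ i ∈ s, KWIn l (f i)) : KWIn l (∑ i ∈ s, f i) := by
  classical
  induction s using Finset.induction_on with
  | empty => simpa using KWIn.zero
  | insert a s ha ih =>
    rw [Finset.sum_insert ha]
    exact (h a (by simp)).add (ih fun i hi => h i (by simp [hi]))

theorem KWIn.y (n : ℕ) : KWIn n (algebraMap F[X] (KWRing p b c) (X ^ n)) := by
  constructor
  · simp [QuadraticAlgebra.algebraMap_eq]
  · simp [QuadraticAlgebra.algebraMap_eq]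

theorem KWIn.omega : KWIn p (QuadraticAlgebra.omega : KWRing p b c) := by
  constructor <;> simp

/-- inverse of `x` -/
noncomputable def kwInv (p : ℕ) (b c : F) : KWRing p b c := ⟨C b⁻¹ * (X ^ p - X + C c), -C b⁻¹⟩

theorem kw_omega_mul_inv (hb : b ≠ 0) : (QuadraticAlgebra.omega : KWRing p b c) * kwInv p b c = 1 := by
  rw [kwInv, QuadraticAlgebra.omega_mul_mk]
  have : (C b * C b⁻¹ : F[X]) = 1 := by rw [← C_mul, mul_inv_cancel₀ hb, C_1]
  ext1
  · simp [QuadraticAlgebra.re_one]; exact this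
  · simp [QuadraticAlgebra.im_one]; ring

theorem KWIn.inv (hp : 1 < p) : KWIn p (kwInv p b c) := by
  constructor
  · rw [kwInv]; simp only
    refine (degree_mul_le _ _).trans ?_
    rw [kw_t_degree hp]
    exact (add_le_add_left degree_C_le _).trans (by simp)
  · rw [kwInv]; simp only
    rw [degree_neg]
    exact (add_le_add_left degree_C_le _).trans (by simp)

theorem KWIn.star (hp : 1 < p) {l : ℕ} {f : KWRing p b c} (hf : KWIn l f) : KWIn l (star f) := by
  constructor
  · rw [QuadraticAlgebra.re_star]
    refine (degree_add_le _ _).trans (max_le hf.1 ?_)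
    rw [degree_mul, kw_t_degree hp, add_comm]; exact hf.2
  · rw [QuadraticAlgebra.im_star, degree_neg]; exact hf.2

theorem KWIn.norm (hp : 1 < p) {l : ℕ} {f : KWRing p b c} (hf : KWIn l f) :
    (QuadraticAlgebra.norm f).natDegree ≤ 2 * l := by
  have h := (hf.mul hp (hf.star hp)).1
  rw [← QuadraticAlgebra.algebraMap_norm_eq_mul_star] at h
  simp only [QuadraticAlgebra.algebraMap_eq] at h
  rw [two_mul]
  exact natDegree_le_iff_degree_le.2 h

theorem kw_poly_aux (hp : 1 < p) (hb : b ≠ 0) (A B t : F[X]) (ht : t.degree = p) (hB0 : B ≠ 0)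
    (h1 : A ^ 2 + t * A * B + C b * B ^ 2 = 0) : False := by
  classical
  let _ : GCDMonoid F[X] := UniqueFactorizationMonoid.toGCDMonoid F[X]
  have hCb : (C b : F[X]) ≠ 0 := C_ne_zero.2 hb
  obtain ⟨A', B', h2, h3, h4⟩ : ∃ A' B' : F[X], A = gcd A B * A' ∧
      B = gcd A B * B' ∧ IsCoprime A' B' := by
    have hg : gcd A B ≠ 0 := by
      intro h; exact hB0 ((gcd_eq_zero_iff _ _).1 h).2
    refine ⟨A / gcd A B, B / gcd A B, ?_, ?_, ?_⟩
    · rw [EuclideanDomain.mul_div_cancel' hg (gcd_dvd_left _ _)]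
    · rw [EuclideanDomain.mul_div_cancel' hg (gcd_dvd_right _ _)]
    · exact isCoprime_div_gcd_div_gcd hB0
  have hg : gcd A B ≠ 0 := by
    intro h; exact hB0 ((gcd_eq_zero_iff _ _).1 h).2
  generalize gcd A B = g at h2 h3 hg
  have h5 : A' ^ 2 + t * A' * B' + C b * B' ^ 2 = 0 := by
    rw [h2, h3] at h1
    have : g ^ 2 * (A' ^ 2 + t * A' * B' + C b * B' ^ 2) = 0 := by rw [← h1]; ring
    exact (mul_eq_zero.1 this).resolve_left (pow_ne_zero _ hg)
  have hB'u : IsUnit B' := by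
    have : B' ∣ A' ^ 2 := ⟨-(t * A' + C b * B'), by linear_combination h5⟩
    exact (h4.symm.pow_right (n := 2)).isUnit_of_dvd' dvd_rfl this
  have hA'u : IsUnit A' := by
    have : A' ∣ C b * B' ^ 2 := ⟨-(t * B' + A'), by linear_combination h5⟩
    have h6 : A' ∣ B' ^ 2 := by
      have hu : IsUnit (C b : F[X]) := isUnit_C.2 hb.isUnit
      exact (hu.dvd_mul_left).1 this
    exact (h4.pow_right (n := 2)).isUnit_of_dvd' dvd_rfl h6
  have dA := degree_eq_zero_of_isUnit hA'u
  have dB := degree_eq_zero_of_isUnit hB'u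
  have h7 : (t * A' * B').degree = p := by
    rw [degree_mul, degree_mul, dA, dB, ht]; simp
  have h8 : t * A' * B' = - (A' ^ 2 + C b * B' ^ 2) := by linear_combination h5
  have h9 : (t * A' * B').degree ≤ 0 := by
    rw [h8, degree_neg]
    refine (degree_add_le _ _).trans (max_le ?_ ?_)
    · rw [degree_pow, dA]; simp
    · rw [degree_mul, degree_pow, dB]; simpa using degree_C_le
  rw [h7] at h9
  have : p ≤ 0 := by exact_mod_cast h9
  omega

theorem kw_norm_ne_zero (hp : 1 < p) (hb : b ≠ 0) {f : KWRing p b c} (hf : f ≠ 0) :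
    QuadraticAlgebra.norm f ≠ 0 := by
  intro h
  rw [QuadraticAlgebra.norm_def] at h
  have h1 : f.re ^ 2 + (X ^ p - X + C c) * f.re * f.im + C b * f.im ^ 2 = 0 := by rw [← h]; ring
  refine kw_poly_aux hp hb f.re f.im _ (kw_t_degree hp) ?_ h1
  intro hB0
  rw [hB0] at h1
  have hA : f.re = 0 := by simpa using h1
  exact hf (QuadraticAlgebra.ext hA hB0)

theorem KWIn.val_le {v : Valuation (KWRing p b c) (WithZero (Multiplicative ℤ))}
    (hx : v QuadraticAlgebra.omega = WithZero.exp (p : ℤ))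
    (hA : ∀ A : F[X], A ≠ 0 → v (algebraMap _ _ A) = WithZero.exp (A.natDegree : ℤ))
    {l : ℕ} {f : KWRing p b c} (hf : KWIn l f) : v f ≤ WithZero.exp (l : ℤ) := by
  have h : f = algebraMap _ _ f.re + algebraMap _ _ f.im * QuadraticAlgebra.omega := by
    ext1 <;> simp [QuadraticAlgebra.algebraMap_eq]
  rw [h]
  refine (v.map_add _ _).trans (max_le ?_ ?_)
  · by_cases h0 : f.re = 0
    · rw [h0]; simp
    · rw [hA _ h0, WithZero.exp_le_exp]
      exact_mod_cast natDegree_le_iff_degree_le.2 hf.1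
  · by_cases h0 : f.im = 0
    · rw [h0]; simp
    · rw [map_mul, hA _ h0, hx, ← WithZero.exp_add, WithZero.exp_le_exp]
      have := hf.2
      rw [degree_eq_natDegree h0] at this
      exact_mod_cast this

theorem KWIn.le_val (hp : 1 < p) (hb : b ≠ 0)
    {v : Valuation (KWRing p b c) (WithZero (Multiplicative ℤ))}
    (hx : v QuadraticAlgebra.omega = WithZero.exp (p : ℤ))
    (hA : ∀ A : F[X], A ≠ 0 → v (algebraMap _ _ A) = WithZero.exp (A.natDegree : ℤ))
    {l : ℕ} {f : KWRing p b c} (hf : KWIn l f) (h0 : f ≠ 0) : WithZero.exp (-(l : ℤ)) ≤ v f := by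
  have h1 := hA _ (kw_norm_ne_zero hp hb h0)
  rw [QuadraticAlgebra.algebraMap_norm_eq_mul_star, map_mul] at h1
  have h2 := (hf.star hp).val_le hx hA
  have h3 : (1 : WithZero (Multiplicative ℤ)) ≤ v f * WithZero.exp (l : ℤ) := by
    calc (1 : WithZero (Multiplicative ℤ)) ≤ v f * v (Star.star f) := by
          rw [h1, ← WithZero.exp_zero, WithZero.exp_le_exp]; positivity
      _ ≤ _ := by gcongr
  calc WithZero.exp (-(l : ℤ)) = 1 * WithZero.exp (-(l : ℤ)) := (one_mul _).symm
    _ ≤ v f * WithZero.exp (l : ℤ) * WithZero.exp (-(l : ℤ)) := by gcongr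
    _ = v f := by rw [mul_assoc, ← WithZero.exp_add]; simp

theorem kw_sum_ne_zero {R ι : Type*} [CommRing R] (v : Valuation R (WithZero (Multiplicative ℤ)))
    (s : Finset ι) (hs : s.Nonempty) (g : ι → R) (h0 : ∀ i ∈ s, v (g i) ≠ 0)
    (hd : ∀ i ∈ s, ∀ j ∈ s, i ≠ j → v (g i) ≠ v (g j)) : ∑ i ∈ s, g i ≠ 0 := by
  classical
  obtain ⟨i0, hi0, hmax⟩ := s.exists_max_image (fun i => v (g i)) hs
  intro h
  rw [← Finset.add_sum_erase s g hi0] at h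
  have h1 : v (∑ i ∈ s.erase i0, g i) < v (g i0) := by
    refine v.map_sum_lt (h0 i0 hi0) ?_
    intro i hi
    rw [Finset.mem_erase] at hi
    exact lt_of_le_of_ne (hmax i hi.2) (hd i hi.2 i0 hi0 hi.1)
  have h2 := v.map_add_eq_of_lt_left h1
  rw [h, map_zero] at h2
  exact h0 i0 hi0 h2.symm

theorem kw_zeros [Fintype F] [DecidableEq F] (w : KWRing p b c)
    (hw : QuadraticAlgebra.norm w ≠ 0)
    (h : ∀ x y : F, x ^ 2 - (y ^ p - y + c) * x + b = 0 → w.re.eval y + w.im.eval y * x = 0) :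
    (Finset.univ.filter fun z : F × F => z.1 ^ 2 - (z.2 ^ p - z.2 + c) * z.1 + b = 0).card
      ≤ (QuadraticAlgebra.norm w).natDegree := by
  set N := QuadraticAlgebra.norm w with hN
  have hNd : N = w.re ^ 2 + (X ^ p - X + C c) * w.re * w.im + C b * w.im ^ 2 := by
    rw [hN, QuadraticAlgebra.norm_def]; ring
  have hy : ∀ y : F, (Finset.univ.filter fun x : F => x ^ 2 - (y ^ p - y + c) * x + b = 0).card
      ≤ N.rootMultiplicity y := by
    intro y
    set S := Finset.univ.filter fun x : F => x ^ 2 - (y ^ p - y + c) * x + b = 0 with hS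
    have hS2 : S.card ≤ 2 := by
      by_contra! h3
      obtain ⟨x1, h1, x2, h2, x3, h3, h12, h13, h23⟩ := Finset.two_lt_card.1 h3
      simp only [hS, Finset.mem_filter, Finset.mem_univ, true_and] at h1 h2 h3
      have e1 : (x1 - x2) * (x1 + x2 - (y ^ p - y + c)) = 0 := by linear_combination h1 - h2
      have e2 : (x1 - x3) * (x1 + x3 - (y ^ p - y + c)) = 0 := by linear_combination h1 - h3
      have e1' := (mul_eq_zero.1 e1).resolve_left (sub_ne_zero.2 h12)
      have e2' := (mul_eq_zero.1 e2).resolve_left (sub_ne_zero.2 h13)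
      exact h23 (by linear_combination e1' - e2')
    rcases Nat.lt_or_ge S.card 1 with h1 | h1
    · omega
    rcases Nat.lt_or_ge S.card 2 with h2 | h2
    · have : S.card = 1 := by omega
      rw [this]
      obtain ⟨x, hx⟩ := Finset.card_pos.1 h1
      simp only [hS, Finset.mem_filter, Finset.mem_univ, true_and] at hx
      have hz := h x y hx
      refine (rootMultiplicity_pos hw).2 ?_
      rw [IsRoot, hNd]
      simp only [eval_add, eval_sub, eval_mul, eval_pow, eval_X, eval_C]
      linear_combination (w.re.eval y - w.im.eval y * x + (y ^ p - y + c) * w.im.eval y) * hz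
        + (w.im.eval y) ^ 2 * hx
    · have : S.card = 2 := by omega
      rw [this]
      obtain ⟨x1, h1, x2, h2, h12⟩ := Finset.one_lt_card.1 (show 1 < S.card by omega)
      simp only [hS, Finset.mem_filter, Finset.mem_univ, true_and] at h1 h2
      have z1 := h x1 y h1
      have z2 := h x2 y h2
      have e : w.im.eval y * (x1 - x2) = 0 := by linear_combination z1 - z2
      have e1 : w.im.eval y = 0 := (mul_eq_zero.1 e).resolve_right (sub_ne_zero.2 h12)
      have e2 : w.re.eval y = 0 := by rw [e1] at z1; simpa using z1
      obtain ⟨B, hB⟩ := dvd_iff_isRoot.2 e1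
      obtain ⟨A, hA⟩ := dvd_iff_isRoot.2 e2
      refine (le_rootMultiplicity_iff hw).2 ?_
      rw [hNd, hA, hB]
      exact ⟨A ^ 2 + (X ^ p - X + C c) * A * B + C b * B ^ 2, by ring⟩
  calc _ = ∑ y : F, (Finset.univ.filter fun x : F => x ^ 2 - (y ^ p - y + c) * x + b = 0).card := by
        rw [Finset.card_filter, ← Finset.univ_product_univ, Finset.sum_product_right]
        refine Finset.sum_congr rfl fun y _ => ?_
        rw [Finset.card_filter]
    _ ≤ ∑ y : F, N.roots.count y := by
        refine Finset.sum_le_sum fun y _ => ?_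
        rw [count_roots]; exact hy y
    _ = N.roots.card := by
        rw [Multiset.sum_count_eq_card]; simp
    _ ≤ _ := card_roots' N

end Stepanov


section Stepanov2
variable {F : Type*} [Field F] {p : ℕ} {b c : F}

theorem KWIn.iff (l : ℕ) (f : KWRing p b c) :
    KWIn l f ↔ f.re ∈ degreeLT F (l + 1) ∧ f.im ∈ degreeLT F (l + 1 - p) := by
  rw [KWIn, mem_degreeLT, mem_degreeLT]
  have h1 : f.re.degree ≤ (l : WithBot ℕ) ↔ f.re.degree < ((l + 1 : ℕ) : WithBot ℕ) := by
    by_cases h : f.re = 0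
    · simp [h]
    · rw [degree_eq_natDegree h]; norm_cast; omega
  have h2 : f.im.degree + (p : WithBot ℕ) ≤ (l : WithBot ℕ) ↔
      f.im.degree < ((l + 1 - p : ℕ) : WithBot ℕ) := by
    by_cases h : f.im = 0
    · simp [h]
    · rw [degree_eq_natDegree h]
      have e1 : ((f.im.natDegree : WithBot ℕ) + (p : WithBot ℕ) ≤ (l : WithBot ℕ)) ↔
        f.im.natDegree + p ≤ l := by norm_cast
      have e2 : ((f.im.natDegree : WithBot ℕ) < ((l + 1 - p : ℕ) : WithBot ℕ)) ↔
        f.im.natDegree < l + 1 - p := by norm_cast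
      rw [e1, e2]; omega
  rw [h1, h2]

theorem kw_card_degreeLT [Fintype F] (n : ℕ) : Nat.card (degreeLT F n) = Fintype.card F ^ n := by
  rw [Nat.card_congr (degreeLTEquiv F n).toEquiv]
  simp

/-- the monomials `y ^ i * x ^ (j - M)` -/
noncomputable def kwMon (p : ℕ) (b c : F) (M : ℕ) (s : Fin p × Fin (2 * M + 1)) : KWRing p b c :=
  algebraMap F[X] _ (X ^ (s.1 : ℕ)) * (QuadraticAlgebra.omega ^ (s.2 : ℕ) * kwInv p b c ^ M)

theorem kwMon_in (hp : 1 < p) (hb : b ≠ 0) (M : ℕ) (s : Fin p × Fin (2 * M + 1)) :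
    KWIn (p * M + p - 1) (kwMon p b c M s) := by
  have h1 : KWIn (p * M) ((QuadraticAlgebra.omega : KWRing p b c) ^ (s.2 : ℕ) * kwInv p b c ^ M) := by
    have hs := s.2.2
    rcases le_total M (s.2 : ℕ) with h | h
    · obtain ⟨k, hk⟩ := Nat.exists_eq_add_of_le h
      rw [hk, pow_add, mul_right_comm, ← mul_pow, kw_omega_mul_inv hb, one_pow, one_mul]
      exact (KWIn.omega.pow hp k).mono (Nat.mul_le_mul_left _ (by omega))
    · obtain ⟨k, hk⟩ := Nat.exists_eq_add_of_le h
      have : kwInv p b c ^ M = kwInv p b c ^ (s.2 : ℕ) * kwInv p b c ^ k := by rw [← pow_add, ← hk]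
      rw [this, ← mul_assoc, ← mul_pow, kw_omega_mul_inv hb, one_pow, one_mul]
      exact ((KWIn.inv hp).pow hp k).mono (Nat.mul_le_mul_left _ (by omega))
  have h2 := (KWIn.y (b := b) (c := c) (p := p) (s.1 : ℕ)).mul hp h1
  refine h2.mono ?_
  have := s.1.2
  omega

theorem kwMon_val (hb : b ≠ 0) {v : Valuation (KWRing p b c) (WithZero (Multiplicative ℤ))}
    (hx : v QuadraticAlgebra.omega = WithZero.exp (p : ℤ))
    (hA : ∀ A : F[X], A ≠ 0 → v (algebraMap _ _ A) = WithZero.exp (A.natDegree : ℤ))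
    (M : ℕ) (s : Fin p × Fin (2 * M + 1)) :
    v (kwMon p b c M s) = WithZero.exp ((s.1 : ℤ) + p * ((s.2 : ℤ) - M)) := by
  have hinv : v (kwInv p b c) = WithZero.exp (-(p : ℤ)) := by
    have h := congrArg v (kw_omega_mul_inv (p := p) (c := c) hb)
    rw [map_mul, hx, map_one] at h
    calc v (kwInv p b c) = WithZero.exp (-(p : ℤ)) * (WithZero.exp (p : ℤ) * v (kwInv p b c)) := by
          rw [← mul_assoc, ← WithZero.exp_add]; simp
      _ = _ := by rw [h, mul_one]
  rw [kwMon, map_mul v, map_mul v, map_pow v, map_pow v, hx, hinv, hA _ (pow_ne_zero _ X_ne_zero),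
    natDegree_X_pow, ← WithZero.exp_nsmul, ← WithZero.exp_nsmul, ← WithZero.exp_add,
    ← WithZero.exp_add]
  congr 1
  simp only [nsmul_eq_mul]
  ring

theorem kw_eval_hom (x y : F) (h : x ^ 2 - (y ^ p - y + c) * x + b = 0) :
    ∃ e : KWRing p b c →+* F, ∀ w, e w = w.re.eval y + w.im.eval y * x := by
  let _ : Algebra F[X] F := (evalRingHom y).toAlgebra
  have halg : ∀ A : F[X], algebraMap F[X] F A = A.eval y := fun A => rfl
  let φ : KWRing p b c →ₐ[F[X]] F := QuadraticAlgebra.lift ⟨x, by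
    rw [Algebra.smul_def, Algebra.smul_def, halg, halg]
    simp
    linear_combination h⟩
  refine ⟨φ.toRingHom, fun w => ?_⟩
  have hw : w = algebraMap _ _ w.re + algebraMap _ _ w.im * QuadraticAlgebra.omega := by
    ext1 <;> simp [QuadraticAlgebra.algebraMap_eq]
  change φ w = _
  conv_lhs => rw [hw]
  rw [map_add, map_mul, AlgHom.commutes, AlgHom.commutes, halg, halg]
  congr 2
  simp [φ]

theorem kw_aux_exists [Fintype F] (hp : 1 < p) (hb : b ≠ 0) (hprime : p.Prime) [CharP F p]
    (μ l M : ℕ)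
    (hcount : (l * p ^ μ + (p * M + p - 1) + 1) + (l * p ^ μ + (p * M + p - 1) + 1 - p) <
      ((l + 1) + (l + 1 - p)) * (p * (2 * M + 1))) :
    ∃ f : Fin p × Fin (2 * M + 1) → KWRing p b c, (∀ s, KWIn l (f s)) ∧ (∃ s, f s ≠ 0) ∧
      ∑ s, f s ^ (p ^ μ) * kwMon p b c M s = 0 := by
  classical
  have : Fact p.Prime := ⟨hprime⟩
  have hinj : Function.Injective (algebraMap F[X] (KWRing p b c)) := by
    intro A B h
    exact congrArg QuadraticAlgebra.re h
  have hchar : CharP (KWRing p b c) p := charP_of_injective_algebraMap hinj p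
  set L := l * p ^ μ + (p * M + p - 1) with hL
  let D : ℕ → Type _ := fun l => degreeLT F (l + 1) × degreeLT F (l + 1 - p)
  have hfin : ∀ n, Finite (degreeLT F n) := fun n => Finite.of_equiv _ (degreeLTEquiv F n).toEquiv.symm
  have hfinD : ∀ l, Finite (D l) := fun l => by
    have := hfin (l + 1); have := hfin (l + 1 - p); exact Finite.instProd
  have hcardD : ∀ l, Nat.card (D l) = Fintype.card F ^ ((l + 1) + (l + 1 - p)) := fun l => by
    rw [Nat.card_prod, kw_card_degreeLT, kw_card_degreeLT, ← pow_add]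
  let toR : ∀ l, D l → KWRing p b c := fun l d => ⟨d.1, d.2⟩
  have htoR : ∀ l (d : D l), KWIn l (toR l d) := fun l d => (KWIn.iff l _).2 ⟨d.1.2, d.2.2⟩
  have htoRinj : ∀ l, Function.Injective (toR l) := by
    intro l d e h
    have h1 := congrArg QuadraticAlgebra.re h
    have h2 := congrArg QuadraticAlgebra.im h
    exact Prod.ext (Subtype.ext h1) (Subtype.ext h2)
  let Ψ : (Fin p × Fin (2 * M + 1) → D l) → KWRing p b c :=
    fun g => ∑ s, (toR l (g s)) ^ (p ^ μ) * kwMon p b c M s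
  have hΨ : ∀ g, KWIn L (Ψ g) := fun g => KWIn.sum _ _ fun s _ =>
    ((htoR l (g s)).pow hp _).mul hp (kwMon_in hp hb M s)
  let Φ : (Fin p × Fin (2 * M + 1) → D l) → D L := fun g =>
    (⟨(Ψ g).re, ((KWIn.iff L _).1 (hΨ g)).1⟩, ⟨(Ψ g).im, ((KWIn.iff L _).1 (hΨ g)).2⟩)
  have hnot : ¬ Function.Injective Φ := by
    intro hi
    have hle := Nat.card_le_card_of_injective Φ hi
    rw [Nat.card_pi, hcardD] at hle
    simp only [hcardD, Finset.prod_const, Finset.card_univ, Fintype.card_prod, Fintype.card_fin] at hle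
    rw [← pow_mul] at hle
    have := (Nat.pow_le_pow_iff_right Fintype.one_lt_card).1 hle
    omega
  rw [Function.Injective] at hnot
  push Not at hnot
  obtain ⟨g, h, hgh, hne⟩ := hnot
  have hΨe : Ψ g = Ψ h := by
    have h1 := congrArg (fun d : D L => (d.1 : F[X])) hgh
    have h2 := congrArg (fun d : D L => (d.2 : F[X])) hgh
    exact QuadraticAlgebra.ext h1 h2
  refine ⟨fun s => toR l (g s) - toR l (h s), fun s => ?_, ?_, ?_⟩
  · have e : toR l (g s) - toR l (h s) = toR l (g s - h s) := rfl
    change KWIn l (toR l (g s) - toR l (h s))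
    rw [e]; exact htoR l _
  · by_contra! hall
    exact hne (funext fun s => htoRinj l (sub_eq_zero.1 (hall s)))
  · have : ∀ s, (toR l (g s) - toR l (h s)) ^ p ^ μ * kwMon p b c M s =
        toR l (g s) ^ p ^ μ * kwMon p b c M s - toR l (h s) ^ p ^ μ * kwMon p b c M s := by
      intro s; rw [sub_pow_char_pow, sub_mul]
    simp only [this, Finset.sum_sub_distrib]
    exact sub_eq_zero.2 hΨe

theorem kw_stepanov [Fintype F] [DecidableEq F] (hprime : p.Prime) (hodd : p ≠ 2) [CharP F p]
    (hb : b ≠ 0) (μ : ℕ) (hμ : 2 ≤ μ) (hcard : Fintype.card F = (p ^ μ) ^ 2) :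
    (Finset.univ.filter fun z : F × F => z.1 ^ 2 - (z.2 ^ p - z.2 + c) * z.1 + b = 0).card
      ≤ (p ^ μ) ^ 2 + 3 * p * p ^ μ := by
  classical
  have hp := hprime.one_lt
  have hp3 : 3 ≤ p := by have := hprime.two_le; omega
  have hpo : Odd p := hprime.odd_of_ne_two hodd
  have : Fact p.Prime := ⟨hprime⟩
  obtain ⟨l, hl⟩ : Odd (p ^ μ) := hpo.pow
  obtain ⟨M', hM'⟩ : Odd (p ^ (μ - 1)) := hpo.pow
  have hQ : p ^ μ = p * p ^ (μ - 1) := by rw [← pow_succ']; congr 1; omega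
  set Q := p ^ μ with hQdef
  have hQ2 : p * p ≤ Q := by
    rw [hQ]
    refine Nat.mul_le_mul_left _ ?_
    calc p = p ^ 1 := (pow_one p).symm
      _ ≤ _ := Nat.pow_le_pow_right (by omega) (by omega)
  set M := M' + 1 with hM
  have hpM : 2 * (p * M) = Q + p := by rw [hQ, hM', hM]; ring
  have hcount : (l * Q + (p * M + p - 1) + 1) + (l * Q + (p * M + p - 1) + 1 - p) <
      ((l + 1) + (l + 1 - p)) * (p * (2 * M + 1)) := by
    have hlp : p ≤ l + 1 := by nlinarith
    obtain ⟨k, hk⟩ := Nat.exists_eq_add_of_le hlp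
    have e1 : l + 1 - p = k := by omega
    have e2 : l * Q + (p * M + p - 1) + 1 - p = l * Q + p * M := by omega
    have e3 : l * Q + (p * M + p - 1) + 1 = l * Q + p * M + p := by omega
    have e4 : p * (2 * M + 1) = Q + 2 * p := by linarith
    rw [e1, e2, e3, e4]
    have e5 : (l + 1) + k + p = Q + 1 := by omega
    have hz : ((l : ℤ) + 1 + k) = Q + 1 - p := by
      have : ((l + 1 + k + p : ℕ) : ℤ) = ((Q + 1 : ℕ) : ℤ) := by exact_mod_cast e5
      push_cast at this; linarith
    zify at hpM hl hQ2 hp3 ⊢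
    rw [hz]
    nlinarith
  obtain ⟨f, hfin, ⟨s0, hs0⟩, hsum⟩ := kw_aux_exists (c := c) hp hb hprime μ l M hcount
  rw [← hQdef] at hsum
  obtain ⟨v, hx, hA⟩ := kw_exists_place p hp b c
  set w : KWRing p b c := ∑ s, f s * kwMon p b c M s ^ Q with hw
  have hwin : KWIn (l + (p * M + p - 1) * Q) w := KWIn.sum _ _ fun s _ =>
    (hfin s).mul hp ((kwMon_in hp hb M s).pow hp Q)
  have hw0 : w ≠ 0 := by
    have e : w = ∑ s ∈ Finset.univ.filter (fun s => f s ≠ 0), f s * kwMon p b c M s ^ Q := by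
      rw [hw, Finset.sum_filter_of_ne]
      intro s _ h h0
      exact h (by rw [h0, zero_mul])
    rw [e]
    let n : Fin p × Fin (2 * M + 1) → ℤ := fun s => (s.1 : ℤ) + p * ((s.2 : ℤ) - M)
    have hval : ∀ s, v (f s * kwMon p b c M s ^ Q) = v (f s) * WithZero.exp (n s * Q) := by
      intro s
      rw [map_mul, map_pow, kwMon_val hb hx hA, ← WithZero.exp_nsmul]
      congr 2
      simp only [nsmul_eq_mul, n]; ring
    have hninj : ∀ s s', n s = n s' → s = s' := by
      intro s s' h
      have h1 : ((s.1 : ℕ) : ℤ) + p * ((s.2 : ℕ) : ℤ) = ((s'.1 : ℕ) : ℤ) + p * ((s'.2 : ℕ) : ℤ) := by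
        simp only [n] at h; linarith
      have h2 : (s.1 : ℕ) + p * (s.2 : ℕ) = (s'.1 : ℕ) + p * (s'.2 : ℕ) := by exact_mod_cast h1
      have h3 : (s.1 : ℕ) = s'.1 := by
        have := congrArg (· % p) h2
        simpa [Nat.add_mul_mod_self_left, Nat.mod_eq_of_lt s.1.2, Nat.mod_eq_of_lt s'.1.2] using this
      have h4 : (s.2 : ℕ) = s'.2 := by
        rw [h3] at h2
        exact Nat.eq_of_mul_eq_mul_left (by omega) (Nat.add_left_cancel h2)
      exact Prod.ext (Fin.ext h3) (Fin.ext h4)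
    have hlt : ∀ s s', f s ≠ 0 → f s' ≠ 0 → n s < n s' →
        v (f s * kwMon p b c M s ^ Q) < v (f s' * kwMon p b c M s' ^ Q) := by
      intro s s' h h' hn
      rw [hval, hval]
      calc _ ≤ WithZero.exp (l : ℤ) * WithZero.exp (n s * Q) := by
            gcongr; exact (hfin s).val_le hx hA
        _ < WithZero.exp (-(l : ℤ)) * WithZero.exp (n s' * Q) := by
            rw [← WithZero.exp_add, ← WithZero.exp_add, WithZero.exp_lt_exp]
            have hl' : (Q : ℤ) = 2 * l + 1 := by exact_mod_cast hl
            nlinarith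
        _ ≤ _ := by
            gcongr; exact (hfin s').le_val hp hb hx hA h'
    refine kw_sum_ne_zero v _ ⟨s0, by simpa using hs0⟩ _ ?_ ?_
    · intro s hs
      rw [Finset.mem_filter] at hs
      rw [hval]
      refine mul_ne_zero ?_ WithZero.exp_ne_zero
      have := (hfin s).le_val hp hb hx hA hs.2
      intro h0
      rw [h0] at this
      exact WithZero.exp_ne_zero (le_zero_iff.1 this)
    · intro s hs s' hs' hne
      rw [Finset.mem_filter] at hs hs'
      rcases lt_trichotomy (n s) (n s') with h | h | h
      · exact (hlt s s' hs.2 hs'.2 h).ne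
      · exact absurd (hninj s s' h) hne
      · exact (hlt s' s hs'.2 hs.2 h).ne'
  have hz := kw_zeros w (kw_norm_ne_zero hp hb hw0) (by
    intro x y hxy
    obtain ⟨e, he⟩ := kw_eval_hom x y hxy
    rw [← he]
    have h1 : (e w) ^ Q = 0 := by
      have h2 := congrArg e hsum
      rw [map_sum, map_zero] at h2
      rw [hw, map_sum, hQdef, sum_pow_char_pow, ← hQdef, ← h2]
      refine Finset.sum_congr rfl fun s _ => ?_
      rw [map_mul, map_mul, map_pow, map_pow, mul_pow, ← pow_mul, ← sq, ← hcard,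
        FiniteField.pow_card]
    exact pow_eq_zero_iff (by omega) |>.1 h1)
  refine hz.trans ((hwin.norm hp).trans ?_)
  have e : 2 * (p * M + p - 1) + 2 = Q + 3 * p := by omega
  have hk : p * M + p - 1 = (p * M + p - 1) := rfl
  generalize p * M + p - 1 = m at *
  nlinarith

theorem kw_char_bound [Fintype F] [DecidableEq F] (hprime : p.Prime) (hodd : p ≠ 2) [CharP F p]
    (hb : b ≠ 0) (μ : ℕ) (hμ : 2 ≤ μ) (hcard : Fintype.card F = (p ^ μ) ^ 2)
    (ψ : AddChar F ℂ) (hψ : ψ ≠ 1) (hfrob : ∀ y : F, ψ (y ^ p - y) = 1) :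
    ‖∑ x ∈ Finset.univ.filter (fun x : F => x ≠ 0), ψ (x + b * x⁻¹)‖ ≤ 3 * p * p ^ μ + 1 := by
  classical
  set U := Finset.univ.filter (fun x : F => x ≠ 0) with hU
  set Q := p ^ μ with hQ
  let S : F → ℕ := fun c =>
    (Finset.univ.filter fun z : F × F => z.1 ^ 2 - (z.2 ^ p - z.2 + c) * z.1 + b = 0).card
  have hS : ∀ c, S c ≤ Q ^ 2 + 3 * p * Q := fun c => kw_stepanov hprime hodd hb μ hμ hcard
  have hS' : ∀ c, S c = ∑ x ∈ U, ∑ y : F, if c = x + b * x⁻¹ - (y ^ p - y) then 1 else 0 := by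
    intro c
    simp only [S]
    rw [Finset.card_filter, ← Finset.univ_product_univ, Finset.sum_product, hU, Finset.sum_filter]
    refine Finset.sum_congr rfl fun x _ => ?_
    by_cases hx : x = 0
    · simp [hx, hb]
    · simp only [hx, ne_eq, not_false_eq_true, if_true]
      refine Finset.sum_congr rfl fun y _ => ?_
      refine if_congr ?_ rfl rfl
      constructor
      · intro h; field_simp; linear_combination -h
      · intro h; rw [h]; field_simp; ring
  have hq0 : (0 : ℝ) < Fintype.card F := by exact_mod_cast Fintype.card_pos
  have hsumψ : ∑ c : F, ψ c = 0 := by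
    exact AddChar.sum_eq_zero_of_ne_one hψ
  have h1 : ∑ c : F, ψ c * (S c : ℂ) = Fintype.card F * ∑ x ∈ U, ψ (x + b * x⁻¹) := by
    simp only [hS']
    push_cast
    simp only [Finset.mul_sum]
    rw [Finset.sum_comm]
    refine Finset.sum_congr rfl fun x _ => ?_
    rw [Finset.sum_comm]
    have : ∀ y : F, ∑ c : F, ψ c * (if c = x + b * x⁻¹ - (y ^ p - y) then (1 : ℂ) else 0)
        = ψ (x + b * x⁻¹) := by
      intro y
      simp only [mul_ite, mul_one, mul_zero, Finset.sum_ite_eq', Finset.mem_univ, if_true]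
      rw [AddChar.map_sub_eq_div, hfrob, div_one]
    rw [Finset.sum_congr rfl (fun y _ => this y)]
    simp
  have h2 : (∑ c : F, (S c : ℝ)) = Fintype.card F * (Fintype.card F - 1) := by
    have hUc : (U.card : ℝ) = Fintype.card F - 1 := by
      have : U = Finset.univ.erase 0 := by ext; simp [hU]
      rw [this, Finset.card_erase_of_mem (Finset.mem_univ _), Finset.card_univ,
        Nat.cast_sub Fintype.card_pos]; simp
    simp only [hS']
    push_cast
    rw [Finset.sum_comm]
    have : ∀ x ∈ U, ∑ c : F, ∑ y : F, (if c = x + b * x⁻¹ - (y ^ p - y) then (1 : ℝ) else 0)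
        = Fintype.card F := by
      intro x _
      rw [Finset.sum_comm]
      simp
    rw [Finset.sum_congr rfl this]
    simp [hUc]; ring
  set B : ℝ := (Q : ℝ) ^ 2 + 3 * p * Q with hB
  have hSB : ∀ c, (S c : ℝ) ≤ B := fun c => by rw [hB]; exact_mod_cast hS c
  have h3 : (Fintype.card F : ℂ) * ∑ x ∈ U, ψ (x + b * x⁻¹) = ∑ c : F, ψ c * ((S c : ℂ) - B) := by
    simp only [mul_sub, Finset.sum_sub_distrib, ← Finset.sum_mul, hsumψ]
    rw [h1]; simp
  have h4 : (Fintype.card F : ℝ) * ‖∑ x ∈ U, ψ (x + b * x⁻¹)‖ ≤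
      Fintype.card F * B - Fintype.card F * (Fintype.card F - 1) := by
    calc _ = ‖(Fintype.card F : ℂ) * ∑ x ∈ U, ψ (x + b * x⁻¹)‖ := by simp
      _ ≤ ∑ c : F, (B - S c) := by
        rw [h3]
        refine (norm_sum_le _ _).trans (Finset.sum_le_sum fun c _ => ?_)
        rw [norm_mul, AddChar.norm_apply, one_mul]
        have : ((S c : ℂ) - B) = (((S c : ℝ) - B : ℝ) : ℂ) := by push_cast; rfl
        rw [this, Complex.norm_real, Real.norm_eq_abs, abs_sub_comm, abs_of_nonneg (sub_nonneg.2 (hSB c))]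
      _ = _ := by rw [Finset.sum_sub_distrib, h2]; simp
  rw [← mul_sub] at h4
  have h5 := le_of_mul_le_mul_left h4 hq0
  have hc : (Fintype.card F : ℝ) = (Q : ℝ) ^ 2 := by exact_mod_cast hcard
  rw [hB, hc] at h5
  push_cast [hQ] at h5 ⊢
  linarith
end Stepanov2


section LFun
set_option linter.unusedSectionVars false
variable {k : Type*} [Field k] [Fintype k] [DecidableEq k]

/-- Monic polynomials of degree `n`. -/
noncomputable def kwM (k : Type*) [Field k] [Fintype k] [DecidableEq k] (n : ℕ) : Finset k[X] :=
  by
    classical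
    exact (Finset.univ : Finset (Fin n → k)).image (fun c => X ^ n + ∑ i : Fin n, C (c i) * X ^ (i : ℕ))

theorem kwM_mem (n : ℕ) (f : k[X]) : f ∈ kwM k n ↔ f.Monic ∧ f.natDegree = n := by
  classical
  simp only [kwM, Finset.mem_image, Finset.mem_univ, true_and]
  have hd : ∀ c : Fin n → k, (∑ i : Fin n, C (c i) * X ^ (i : ℕ)).degree < (n : WithBot ℕ) := by
    intro c
    refine (degree_sum_fin_lt c)
  constructor
  · rintro ⟨c, rfl⟩
    refine ⟨monic_X_pow_add (hd c), ?_⟩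
    exact natDegree_eq_of_degree_eq_some (by
      rw [degree_add_eq_left_of_degree_lt] <;> rw [degree_X_pow]
      exact hd c)
  · rintro ⟨hm, rfl⟩
    refine ⟨fun i => f.coeff i, ?_⟩
    conv_rhs => rw [hm.as_sum]
    rw [Finset.sum_range]

/-- The completely multiplicative function. -/
noncomputable def kwLam (ψ : AddChar k ℂ) (b : k) (f : k[X]) : ℂ :=
  if f.coeff 0 = 0 then 0 else ψ (-f.nextCoeff - b * (f.coeff 1 / f.coeff 0))

variable (ψ : AddChar k ℂ) (b : k)

theorem kwLam_mul {f g : k[X]} (hf : f.Monic) (hg : g.Monic) :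
    kwLam ψ b (f * g) = kwLam ψ b f * kwLam ψ b g := by
  unfold kwLam
  rw [mul_coeff_zero, mul_coeff_one, hf.nextCoeff_mul hg]
  by_cases h1 : f.coeff 0 = 0
  · simp [h1]
  by_cases h2 : g.coeff 0 = 0
  · simp [h2]
  simp only [h1, h2, mul_eq_zero, or_self, if_false]
  rw [← AddChar.map_add_eq_mul]
  congr 1
  field_simp
  ring

theorem kwLam_one : kwLam ψ b 1 = 1 := by
  simp [kwLam, coeff_one, nextCoeff]

theorem kwLam_pow {f : k[X]} (hf : f.Monic) (n : ℕ) : kwLam ψ b (f ^ n) = kwLam ψ b f ^ n := by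
  induction n with
  | zero => simp [kwLam_one]
  | succ n ih => rw [pow_succ, kwLam_mul ψ b (hf.pow n) hf, ih, pow_succ]

/-- Coefficients of the L-function. -/
noncomputable def kwA (n : ℕ) : ℂ := ∑ f ∈ kwM k n, kwLam ψ b f

theorem kwA_zero : kwA ψ b 0 = 1 := by
  have : kwM k 0 = {1} := by
    ext f
    rw [kwM_mem, Finset.mem_singleton]
    constructor
    · rintro ⟨h1, h2⟩; exact h1.natDegree_eq_zero.1 h2
    · rintro rfl; simp
  rw [kwA, this, Finset.sum_singleton, kwLam_one]

theorem kwA_one : kwA ψ b 1 = ∑ x ∈ Finset.univ.filter (fun x : k => x ≠ 0), ψ (x + b * x⁻¹) := by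
  rw [kwA, Finset.sum_filter]
  symm
  refine Finset.sum_bij (fun x _ => X + C (-x)) ?_ ?_ ?_ ?_
  · intro x _
    rw [kwM_mem]
    exact ⟨monic_X_add_C _, natDegree_X_add_C _⟩
  · intro x _ y _ h
    simpa using h
  · intro f hf
    rw [kwM_mem] at hf
    refine ⟨-f.coeff 0, Finset.mem_univ _, ?_⟩
    rw [neg_neg]
    exact (hf.1.eq_X_add_C hf.2).symm
  · intro x _
    simp only [kwLam, nextCoeff_X_add_C]
    by_cases hx : x = 0
    · simp [hx]
    · simp [hx, div_neg]

theorem kwA_large (hψ : ψ ≠ 1) (n : ℕ) (hn : 3 ≤ n) : kwA ψ b n = 0 := by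
  obtain ⟨t, ht⟩ : ∃ t, ψ t ≠ 1 := by
    by_contra h
    push Not at h
    exact hψ (by ext x; simp [h x])
  have hdeg : ∀ s : k, (C s * X ^ (n - 1) : k[X]).degree < (n : WithBot ℕ) := by
    intro s
    refine (degree_C_mul_X_pow_le _ _).trans_lt ?_
    exact_mod_cast (by omega : n - 1 < n)
  have hmem : ∀ s : k, ∀ f ∈ kwM k n, f + C s * X ^ (n - 1) ∈ kwM k n := by
    intro s f hf
    rw [kwM_mem] at hf ⊢
    have hdf : f.degree = n := by rw [degree_eq_natDegree hf.1.ne_zero, hf.2]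
    refine ⟨hf.1.add_of_left (by rw [hdf]; exact hdeg s), ?_⟩
    refine natDegree_eq_of_degree_eq_some ?_
    rw [degree_add_eq_left_of_degree_lt (by rw [hdf]; exact hdeg s), hdf]
  have key : kwA ψ b n = kwA ψ b n * ψ t := by
    rw [kwA, Finset.sum_mul]
    refine Finset.sum_bij (fun f _ => f + C t * X ^ (n - 1)) (hmem t) ?_ ?_ ?_
    · intro f _ g _ h; simpa using h
    · intro f hf
      refine ⟨f + C (-t) * X ^ (n - 1), hmem _ f hf, ?_⟩
      simp
    · intro f hf
      have h1 := (kwM_mem n _).1 (hmem t f hf)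
      have h0 := (kwM_mem n _).1 hf
      unfold kwLam
      have e0 : (f + C t * X ^ (n - 1)).coeff 0 = f.coeff 0 := by
        rw [coeff_add, coeff_C_mul, coeff_X_pow, if_neg (by omega)]; simp
      have e1 : (f + C t * X ^ (n - 1)).coeff 1 = f.coeff 1 := by
        rw [coeff_add, coeff_C_mul, coeff_X_pow, if_neg (by omega)]; simp
      have e2 : (f + C t * X ^ (n - 1)).nextCoeff = f.nextCoeff + t := by
        rw [nextCoeff_of_natDegree_pos (by omega), nextCoeff_of_natDegree_pos (by omega), h1.2, h0.2]
        simp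
      rw [e0, e1, e2]
      split_ifs
      · simp
      · rw [← AddChar.map_add_eq_mul]; congr 1; ring
  have : kwA ψ b n * (ψ t - 1) = 0 := by rw [mul_sub, mul_one, ← key, sub_self]
  exact (mul_eq_zero.1 this).resolve_right (sub_ne_zero.2 ht)

theorem kwA_two (hψ : ψ ≠ 1) (hb : b ≠ 0) : kwA ψ b 2 = Fintype.card k := by
  have h1 : kwA ψ b 2 = ∑ v : k, ∑ u : k, if v = 0 then 0 else ψ (u * (-1 - b / v)) := by
    rw [kwA, ← Finset.sum_product' (s := Finset.univ) (t := Finset.univ)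
      (f := fun v u : k => if v = 0 then 0 else ψ (u * (-1 - b / v)))]
    symm
    refine Finset.sum_bij (fun z _ => X ^ 2 + C z.2 * X + C z.1) ?_ ?_ ?_ ?_
    · intro z _
      rw [kwM_mem]
      have : (X ^ 2 + C z.2 * X + C z.1 : k[X]) = C 1 * X ^ 2 + C z.2 * X + C z.1 := by simp
      rw [this]
      exact ⟨leadingCoeff_quadratic one_ne_zero, natDegree_quadratic one_ne_zero⟩
    · intro z _ z' _ h
      have a0 := congrArg (fun f => coeff f 0) h
      have a1 := congrArg (fun f => coeff f 1) h
      simp [coeff_X, coeff_X_pow, coeff_C] at a0 a1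
      exact Prod.ext a0 a1
    · intro f hf
      rw [kwM_mem] at hf
      refine ⟨(f.coeff 0, f.coeff 1), by simp, ?_⟩
      conv_rhs => rw [hf.1.as_sum, hf.2]
      simp [Finset.sum_range_succ]
      ring
    · rintro ⟨v, u⟩ _
      have hq : (X ^ 2 + C u * X + C v : k[X]) = C 1 * X ^ 2 + C u * X + C v := by simp
      have hnd : (X ^ 2 + C u * X + C v : k[X]).natDegree = 2 := by
        rw [hq]; exact natDegree_quadratic one_ne_zero
      have hc0 : (X ^ 2 + C u * X + C v : k[X]).coeff 0 = v := by simp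
      have hc1 : (X ^ 2 + C u * X + C v : k[X]).coeff 1 = u := by simp [coeff_X_pow, coeff_C]
      unfold kwLam
      have hpos : 0 < (X ^ 2 + C u * X + C v : k[X]).natDegree := by rw [hnd]; norm_num
      rw [nextCoeff_of_natDegree_pos hpos, hnd, hc0]
      simp only [Nat.add_one_sub_one, hc1]
      split_ifs
      · rfl
      · congr 1; ring
  rw [h1]
  have h2 : ∀ v : k, (∑ u : k, if v = 0 then (0 : ℂ) else ψ (u * (-1 - b / v))) =
      if v = -b then (Fintype.card k : ℂ) else 0 := by
    intro v
    by_cases hv : v = 0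
    · simp [hv, hb]
    · simp only [hv, if_false]
      have := AddChar.sum_mulShift (R := k) (R' := ℂ) (-1 - b / v) (ψ := ψ)
        (AddChar.IsPrimitive.of_ne_one hψ)
      rw [this]
      have : -1 - b / v = 0 ↔ v = -b := by
        constructor
        · intro h; field_simp at h; linear_combination -h
        · intro h; subst h; field_simp; ring
      simp only [this]
      push_cast; rfl
  rw [Finset.sum_congr rfl (fun v _ => h2 v)]
  simp

end LFun


section LFun2
variable {k : Type*} [Field k] [Fintype k] [DecidableEq k]

open Classical in
/-- Monic irreducible polynomials of degree `n`. -/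
noncomputable def kwI (k : Type*) [Field k] [Fintype k] [DecidableEq k] (n : ℕ) : Finset k[X] :=
  (kwM k n).filter Irreducible

open Classical in
theorem kwI_mem (n : ℕ) (f : k[X]) :
    f ∈ kwI k n ↔ f.Monic ∧ f.natDegree = n ∧ Irreducible f := by
  unfold kwI
  rw [Finset.mem_filter, kwM_mem, and_assoc]

open Classical in
theorem kw_degree_sum (n : ℕ) (f : k[X]) (hf : f ∈ kwM k n) :
    ∑ d ∈ Finset.Icc 1 n, ∑ κ ∈ Finset.Icc 1 n, ∑ P ∈ kwI k d, (if P ^ κ ∣ f then d else 0) = n := by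
  rw [kwM_mem] at hf
  obtain ⟨hm, hn⟩ := hf
  have hf0 := hm.ne_zero
  set nf := UniqueFactorizationMonoid.normalizedFactors f with hnf
  have hprod : nf.prod = f := by
    rw [hnf, UniqueFactorizationMonoid.prod_normalizedFactors_eq hf0, hm.normalize_eq_self]
  have hmon : ∀ P ∈ nf, P.Monic ∧ Irreducible P := by
    intro P hP
    have hi := UniqueFactorizationMonoid.irreducible_of_normalized_factor P hP
    refine ⟨?_, hi⟩
    rw [← UniqueFactorizationMonoid.normalize_normalized_factor P hP]
    exact monic_normalize hi.ne_zero
  have hdeg : n = ∑ P ∈ nf.toFinset, nf.count P * P.natDegree := by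
    rw [← hn]
    conv_lhs => rw [← hprod]
    rw [natDegree_multiset_prod_of_monic _ (fun P hP => (hmon P hP).1),
      Finset.sum_multiset_map_count]
    simp
  have hdvd : ∀ P : k[X], P.Monic → Irreducible P → ∀ κ, P ^ κ ∣ f ↔ κ ≤ nf.count P := by
    intro P hP hi κ
    rw [pow_dvd_iff_le_emultiplicity,
      UniqueFactorizationMonoid.emultiplicity_eq_count_normalizedFactors hi hf0,
      hP.normalize_eq_self]
    norm_cast
  have hinner : ∀ d ∈ Finset.Icc 1 n, ∀ P ∈ kwI k d,
      ∑ κ ∈ Finset.Icc 1 n, (if P ^ κ ∣ f then d else 0) = nf.count P * d := by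
    intro d hd P hP
    rw [kwI_mem] at hP
    have hle : nf.count P ≤ n := by
      have h1 : P ^ (nf.count P) ∣ f := (hdvd P hP.1 hP.2.2 _).2 le_rfl
      have h2 := natDegree_le_of_dvd h1 hf0
      rw [natDegree_pow, hn, hP.2.1] at h2
      have := (Finset.mem_Icc.1 hd).1
      nlinarith
    simp only [hdvd P hP.1 hP.2.2]
    rw [← Finset.sum_filter]
    have : (Finset.Icc 1 n).filter (fun κ => κ ≤ nf.count P) = Finset.Icc 1 (nf.count P) := by
      ext κ; simp only [Finset.mem_filter, Finset.mem_Icc]; omega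
    rw [this]; simp
  have hmaps : ∀ P ∈ nf.toFinset, P.natDegree ∈ Finset.Icc 1 n := by
    intro P hP
    rw [Multiset.mem_toFinset] at hP
    rw [Finset.mem_Icc]
    refine ⟨(hmon P hP).2.natDegree_pos, ?_⟩
    rw [← hn]
    exact natDegree_le_of_dvd (UniqueFactorizationMonoid.dvd_of_mem_normalizedFactors hP) hf0
  conv_rhs => rw [hdeg, ← Finset.sum_fiberwise_of_maps_to hmaps]
  refine Finset.sum_congr rfl fun d hd => ?_
  rw [Finset.sum_comm, Finset.sum_congr rfl (hinner d hd)]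
  symm
  rw [Finset.sum_congr rfl (g := fun P => nf.count P * d)]
  · refine Finset.sum_subset ?_ ?_
    · intro P hP
      rw [Finset.mem_filter, Multiset.mem_toFinset] at hP
      rw [kwI_mem]
      exact ⟨(hmon P hP.1).1, hP.2, (hmon P hP.1).2⟩
    · intro P hP hP'
      rw [kwI_mem] at hP
      rw [Finset.mem_filter, Multiset.mem_toFinset] at hP'
      have : P ∉ nf := fun h => hP' ⟨h, hP.2.1⟩
      rw [Multiset.count_eq_zero_of_notMem this, zero_mul]
  · intro P hP
    rw [(Finset.mem_filter.1 hP).2]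

variable (ψ : AddChar k ℂ) (b : k)

/-- Power sums attached to the L-function. -/
noncomputable def kwK (j : ℕ) : ℂ :=
  ∑ z ∈ j.divisorsAntidiagonal, ∑ P ∈ kwI k z.1, (z.1 : ℂ) * kwLam ψ b P ^ z.2

open Classical in
theorem kw_newton (n : ℕ) : (n : ℂ) * kwA ψ b n = ∑ j ∈ Finset.Icc 1 n, kwK ψ b j * kwA ψ b (n - j) := by
  have h1 : (n : ℂ) * kwA ψ b n = ∑ d ∈ Finset.Icc 1 n, ∑ κ ∈ Finset.Icc 1 n, ∑ P ∈ kwI k d,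
      ∑ f ∈ kwM k n, (if P ^ κ ∣ f then (d : ℂ) * kwLam ψ b f else 0) := by
    rw [kwA, Finset.mul_sum]
    have : ∀ f ∈ kwM k n, (n : ℂ) * kwLam ψ b f = ∑ d ∈ Finset.Icc 1 n, ∑ κ ∈ Finset.Icc 1 n,
        ∑ P ∈ kwI k d, (if P ^ κ ∣ f then (d : ℂ) * kwLam ψ b f else 0) := by
      intro f hf
      have h := congrArg (Nat.cast : ℕ → ℂ) (kw_degree_sum n f hf)
      rw [← h]
      push_cast
      simp only [Finset.sum_mul, ite_mul, zero_mul]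
    rw [Finset.sum_congr rfl this, Finset.sum_comm]
    refine Finset.sum_congr rfl fun d _ => ?_
    rw [Finset.sum_comm]
    refine Finset.sum_congr rfl fun κ _ => ?_
    rw [Finset.sum_comm]
  have h2 : ∀ d κ : ℕ, ∀ P ∈ kwI k d,
      ∑ f ∈ kwM k n, (if P ^ κ ∣ f then (d : ℂ) * kwLam ψ b f else 0) =
        if d * κ ≤ n then (d : ℂ) * kwLam ψ b P ^ κ * kwA ψ b (n - d * κ) else 0 := by
    intro d κ P hP
    rw [kwI_mem] at hP
    have hPm := hP.1.pow κ
    have hPd : (P ^ κ).natDegree = d * κ := by rw [natDegree_pow, hP.2.1, mul_comm]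
    rw [← Finset.sum_filter]
    split_ifs with hle
    · rw [kwA, Finset.mul_sum]
      symm
      refine Finset.sum_bij (fun h _ => P ^ κ * h) ?_ ?_ ?_ ?_
      · intro h hh
        rw [kwM_mem] at hh
        rw [Finset.mem_filter, kwM_mem]
        refine ⟨⟨hPm.mul hh.1, ?_⟩, dvd_mul_right _ _⟩
        rw [hPm.natDegree_mul hh.1, hPd, hh.2]; omega
      · intro h _ h' _ e
        exact mul_left_cancel₀ hPm.ne_zero e
      · intro f hf
        rw [Finset.mem_filter, kwM_mem] at hf
        obtain ⟨⟨hfm, hfd⟩, h, rfl⟩ := hf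
        have hh := hPm.of_mul_monic_left hfm
        refine ⟨h, ?_, rfl⟩
        rw [kwM_mem]
        refine ⟨hh, ?_⟩
        rw [hPm.natDegree_mul hh, hPd] at hfd; omega
      · intro h hh
        rw [kwM_mem] at hh
        rw [kwLam_mul ψ b hPm hh.1, kwLam_pow ψ b hP.1]; ring
    · refine Finset.sum_eq_zero ?_
      intro f hf
      rw [Finset.mem_filter, kwM_mem] at hf
      have := natDegree_le_of_dvd hf.2 hf.1.1.ne_zero
      omega
  have h3 : ∀ d κ : ℕ, ∑ P ∈ kwI k d,
      ∑ f ∈ kwM k n, (if P ^ κ ∣ f then (d : ℂ) * kwLam ψ b f else 0) =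
        if d * κ ≤ n then (∑ P ∈ kwI k d, (d : ℂ) * kwLam ψ b P ^ κ) * kwA ψ b (n - d * κ) else 0 := by
    intro d κ
    rw [Finset.sum_congr rfl (h2 d κ)]
    split_ifs
    · rw [Finset.sum_mul]
    · simp
  rw [h1]
  simp only [h3]
  rw [← Finset.sum_product' (s := Finset.Icc 1 n) (t := Finset.Icc 1 n)
    (f := fun d κ => if d * κ ≤ n then (∑ P ∈ kwI k d, (d : ℂ) * kwLam ψ b P ^ κ) * kwA ψ b (n - d * κ) else 0),
    ← Finset.sum_filter]
  have hmaps : ∀ z ∈ ((Finset.Icc 1 n) ×ˢ (Finset.Icc 1 n)).filter (fun z => z.1 * z.2 ≤ n),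
      z.1 * z.2 ∈ Finset.Icc 1 n := by
    intro z hz
    rw [Finset.mem_filter, Finset.mem_product, Finset.mem_Icc, Finset.mem_Icc] at hz
    rw [Finset.mem_Icc]
    exact ⟨Nat.mul_pos hz.1.1.1 hz.1.2.1, hz.2⟩
  rw [← Finset.sum_fiberwise_of_maps_to hmaps]
  refine Finset.sum_congr rfl fun j hj => ?_
  rw [kwK, Finset.sum_mul]
  rw [Finset.mem_Icc] at hj
  refine Finset.sum_congr ?_ ?_
  · ext z
    simp only [Finset.mem_filter, Finset.mem_product, Finset.mem_Icc, Nat.mem_divisorsAntidiagonal]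
    constructor
    · rintro ⟨_, h⟩; exact ⟨h, by omega⟩
    · rintro ⟨h, h0⟩
      have h1 : 1 ≤ z.1 := Nat.pos_of_ne_zero (by rintro e; rw [e] at h; omega)
      have h2 : 1 ≤ z.2 := Nat.pos_of_ne_zero (by rintro e; rw [e] at h; omega)
      exact ⟨⟨⟨⟨h1, by nlinarith⟩, h2, by nlinarith⟩, by omega⟩, h⟩
  · intro z hz
    rw [Nat.mem_divisorsAntidiagonal] at hz
    rw [hz.1]

theorem kwK_formula (hψ : ψ ≠ 1) (hb : b ≠ 0) (α β : ℂ) (h1 : α + β = -kwA ψ b 1)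
    (h2 : α * β = Fintype.card k) (n : ℕ) : kwK ψ b (n + 1) = -(α ^ (n + 1) + β ^ (n + 1)) := by
  have e0 := kwA_zero ψ b
  have e2 := kwA_two ψ b hψ hb
  have k1 : kwK ψ b 1 = -(α + β) := by
    have := kw_newton ψ b 1
    simp [e0] at this
    rw [← this, h1, neg_neg]
  have k2 : kwK ψ b 2 = -(α ^ 2 + β ^ 2) := by
    have := kw_newton ψ b 2
    rw [show Finset.Icc 1 2 = {1, 2} by rfl, Finset.sum_pair (by norm_num)] at this
    simp only [Nat.add_one_sub_one, Nat.sub_self, e0, e2, k1, ← h2] at this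
    have h : kwA ψ b 1 = -(α + β) := by rw [h1, neg_neg]
    rw [h] at this
    push_cast at this
    linear_combination -this
  induction n using Nat.twoStepInduction with
  | zero => simpa using k1
  | one => exact k2
  | more n ih1 ih2 =>
    have h := kw_newton ψ b (n + 3)
    rw [kwA_large ψ b hψ (n + 3) (by omega)] at h
    have hs : ∑ j ∈ Finset.Icc 1 (n + 3), kwK ψ b j * kwA ψ b (n + 3 - j) =
        ∑ j ∈ ({n + 1, n + 2, n + 3} : Finset ℕ), kwK ψ b j * kwA ψ b (n + 3 - j) := by
      symm
      refine Finset.sum_subset ?_ ?_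
      · intro j hj
        simp only [Finset.mem_insert, Finset.mem_singleton] at hj
        rw [Finset.mem_Icc]; omega
      · intro j hj hj'
        simp only [Finset.mem_insert, Finset.mem_singleton] at hj'
        rw [Finset.mem_Icc] at hj
        rw [kwA_large ψ b hψ _ (by omega), mul_zero]
    rw [hs, Finset.sum_insert (by simp), Finset.sum_pair (by simp)] at h
    rw [show n + 3 - (n + 1) = 2 by omega, show n + 3 - (n + 2) = 1 by omega,
      show n + 3 - (n + 3) = 0 by omega, e0, e2, ← h2, ih1,
      show kwA ψ b 1 = -(α + β) by rw [h1, neg_neg]] at h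
    rw [show n + 1 + 1 = n + 2 by rfl] at ih2
    rw [ih2] at h
    rw [show n + 2 + 1 = n + 3 by rfl]
    linear_combination -h

end LFun2


section LFun3
set_option linter.unusedSectionVars false
variable {k : Type*} [Field k] [Fintype k] [DecidableEq k]
variable {F : Type*} [Field F] [Fintype F] [DecidableEq F] [Algebra k F]

theorem kw_minpoly_inv (x : F) (hx : x ≠ 0) :
    (minpoly k x⁻¹).nextCoeff = (minpoly k x).coeff 1 / (minpoly k x).coeff 0 ∧
    (minpoly k x⁻¹).natDegree = (minpoly k x).natDegree := by
  have hxint : IsIntegral k x := IsIntegral.of_finite k x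
  have hxint' : IsIntegral k x⁻¹ := IsIntegral.of_finite k x⁻¹
  set P := minpoly k x with hP
  have hPm : P.Monic := minpoly.monic hxint
  have hc0 : P.coeff 0 ≠ 0 := minpoly.coeff_zero_ne_zero hxint hx
  have hpos : 0 < P.natDegree := minpoly.natDegree_pos hxint
  have hdeg : (minpoly k x⁻¹).natDegree = P.natDegree := by
    rw [← IntermediateField.adjoin.finrank hxint', hP, ← IntermediateField.adjoin.finrank hxint]
    have : IntermediateField.adjoin k {x⁻¹} = IntermediateField.adjoin k {x} := by
      apply le_antisymm
      · rw [IntermediateField.adjoin_simple_le_iff]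
        exact inv_mem (IntermediateField.mem_adjoin_simple_self k x)
      · rw [IntermediateField.adjoin_simple_le_iff]
        have := inv_mem (IntermediateField.mem_adjoin_simple_self k x⁻¹)
        rwa [inv_inv] at this
    rw [this]
  have hrd : P.reverse.natDegree = P.natDegree := by
    rw [reverse_natDegree, natTrailingDegree_eq_zero_of_constantCoeff_ne_zero (by simpa using hc0)]
    rfl
  have hroot : aeval x⁻¹ P.reverse = 0 := by
    let := invertibleOfNonzero hx
    rw [aeval_def, ← invOf_eq_inv x, eval₂_reverse_eq_zero_iff, ← aeval_def]
    exact minpoly.aeval k x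
  have hr0 : P.reverse ≠ 0 := by rw [Ne, reverse_eq_zero]; exact hPm.ne_zero
  have hrl : P.reverse.leadingCoeff = P.coeff 0 := by
    rw [leadingCoeff, hrd, coeff_reverse, revAt_le le_rfl, Nat.sub_self]
  have heq : P.reverse = C (P.coeff 0) * minpoly k x⁻¹ := by
    obtain ⟨g, hg⟩ := minpoly.dvd k x⁻¹ hroot
    have hg0 : g ≠ 0 := by rintro rfl; rw [mul_zero] at hg; exact hr0 hg
    have hgd : g.natDegree = 0 := by
      have := congrArg natDegree hg
      rw [natDegree_mul (minpoly.ne_zero hxint') hg0, hrd, hdeg] at this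
      omega
    obtain ⟨c, hc⟩ := natDegree_eq_zero.1 hgd
    have : P.coeff 0 = c := by
      rw [← hrl, hg, leadingCoeff_mul, minpoly.monic hxint', one_mul, ← hc, leadingCoeff_C]
    rw [hg, this, ← hc, mul_comm]
  refine ⟨?_, hdeg⟩
  rw [eq_div_iff hc0, nextCoeff_of_natDegree_pos (by omega), hdeg]
  have h1 := congrArg (fun f => coeff f (P.natDegree - 1)) heq
  simp only [coeff_C_mul] at h1
  rw [coeff_reverse, revAt_le (by omega), show P.natDegree - (P.natDegree - 1) = 1 by omega] at h1
  rw [h1, mul_comm]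

variable (ψ : AddChar k ℂ) (b : k)

theorem kwLam_minpoly (x : F) (hx : x ≠ 0) :
    kwLam ψ b (minpoly k x) ^ (Module.finrank k F / (minpoly k x).natDegree) =
      ψ (Algebra.trace k F (x + algebraMap k F b * x⁻¹)) := by
  have hxint : IsIntegral k x := IsIntegral.of_finite k x
  have hc0 : (minpoly k x).coeff 0 ≠ 0 := minpoly.coeff_zero_ne_zero hxint hx
  have hfr : ∀ y : F, Module.finrank (IntermediateField.adjoin k {y}) F =
      Module.finrank k F / (minpoly k y).natDegree := by
    intro y
    rw [← IntermediateField.adjoin.finrank (IsIntegral.of_finite k y)]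
    symm
    refine Nat.div_eq_of_eq_mul_right Module.finrank_pos ?_
    rw [Module.finrank_mul_finrank]
  obtain ⟨h1, h2⟩ := kw_minpoly_inv (k := k) x hx
  rw [kwLam, if_neg hc0, ← AddChar.map_nsmul_eq_pow, map_add, ← Algebra.smul_def, (Algebra.trace k F).map_smul,
    trace_eq_finrank_mul_minpoly_nextCoeff, trace_eq_finrank_mul_minpoly_nextCoeff, hfr, hfr, h1, h2]
  congr 1
  rw [nsmul_eq_mul, smul_eq_mul]
  ring

theorem kw_card_minpoly (P : k[X]) (hP : P.Monic) (hi : Irreducible P)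
    (hd : P.natDegree ∣ Module.finrank k F) :
    (Finset.univ.filter fun x : F => minpoly k x = P).card = P.natDegree := by
  have hdvd : P ∣ X ^ (Fintype.card F) - X := by
    have := hi.natDegree_dvd_iff_dvd_X_pow_card_pow_sub_X.1 hd
    rwa [Nat.card_eq_fintype_card, ← Module.card_eq_pow_finrank] at this
  have hq1 : 1 < Fintype.card F := Fintype.one_lt_card
  have hsplit : (P.map (algebraMap k F)).Splits := by
    have h1 : ((X ^ (Fintype.card F) - X : k[X]).map (algebraMap k F)).Splits :=
      (FiniteField.isSplittingField_sub F k).splits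
    refine h1.of_dvd ?_ (Polynomial.map_dvd _ hdvd)
    rw [Polynomial.map_sub, Polynomial.map_pow, map_X]
    exact FiniteField.X_pow_card_sub_X_ne_zero F hq1
  have hsep : P.Separable := PerfectField.separable_of_irreducible hi
  rw [← card_rootSet_eq_natDegree hsep hsplit, ← Set.toFinset_card]
  congr 1
  ext x
  simp only [Finset.mem_filter, Finset.mem_univ, true_and, Set.mem_toFinset, mem_rootSet]
  constructor
  · rintro rfl; exact ⟨hi.ne_zero, minpoly.aeval k x⟩
  · rintro ⟨_, h⟩; exact (minpoly.eq_of_irreducible_of_monic hi h hP).symm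

theorem kwK_field : kwK ψ b (Module.finrank k F) =
    ∑ x ∈ Finset.univ.filter (fun x : F => x ≠ 0),
      ψ (Algebra.trace k F (x + algebraMap k F b * x⁻¹)) := by
  classical
  set n := Module.finrank k F with hn
  have hnpos : 0 < n := Module.finrank_pos
  have hdvd : ∀ x : F, (minpoly k x).natDegree ∣ n := by
    intro x
    rw [← IntermediateField.adjoin.finrank (IsIntegral.of_finite k x)]
    exact Dvd.intro _ (Module.finrank_mul_finrank k (IntermediateField.adjoin k {x}) F)
  have h1 : ∑ x ∈ Finset.univ.filter (fun x : F => x ≠ 0),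
      ψ (Algebra.trace k F (x + algebraMap k F b * x⁻¹)) =
      ∑ x : F, kwLam ψ b (minpoly k x) ^ (n / (minpoly k x).natDegree) := by
    rw [Finset.sum_filter]
    refine Finset.sum_congr rfl fun x _ => ?_
    by_cases hx : x = 0
    · subst hx
      have hn0 : n ≠ 0 := by omega
      simp [kwLam, minpoly.zero, hn0]
    · rw [if_pos hx, kwLam_minpoly ψ b x hx]
  rw [h1, kwK, Nat.sum_divisorsAntidiagonal
    (f := fun d κ => ∑ P ∈ kwI k d, (d : ℂ) * kwLam ψ b P ^ κ)]
  have hm1 : ∀ x ∈ (Finset.univ : Finset F), (minpoly k x).natDegree ∈ n.divisors := by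
    intro x _
    rw [Nat.mem_divisors]; exact ⟨hdvd x, by omega⟩
  rw [← Finset.sum_fiberwise_of_maps_to hm1]
  refine Finset.sum_congr rfl fun d hd => ?_
  rw [Nat.mem_divisors] at hd
  have hm2 : ∀ x ∈ Finset.univ.filter (fun x : F => (minpoly k x).natDegree = d),
      minpoly k x ∈ kwI k d := by
    intro x hx
    rw [kwI_mem]
    have hxint := IsIntegral.of_finite k x
    exact ⟨minpoly.monic hxint, (Finset.mem_filter.1 hx).2, minpoly.irreducible hxint⟩
  rw [← Finset.sum_fiberwise_of_maps_to hm2]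
  refine Finset.sum_congr rfl fun P hP => ?_
  rw [kwI_mem] at hP
  have hset : (Finset.univ.filter (fun x : F => (minpoly k x).natDegree = d)).filter
      (fun x => minpoly k x = P) = Finset.univ.filter fun x : F => minpoly k x = P := by
    ext x
    simp only [Finset.mem_filter, Finset.mem_univ, true_and, and_iff_right_iff_imp]
    rintro rfl; exact hP.2.1
  rw [hset]
  have hc := kw_card_minpoly (F := F) P hP.1 hP.2.2 (by rw [hP.2.1]; exact hd.1)
  rw [hP.2.1] at hc
  rw [Finset.sum_congr rfl (g := fun _ => kwLam ψ b P ^ (n / d))]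
  · rw [Finset.sum_const, hc, nsmul_eq_mul]
  · intro x hx
    rw [(Finset.mem_filter.1 hx).2, hP.2.1]

end LFun3

theorem kw_norm_le_of_pow {α β : ℂ} {q B : ℝ} (hq : 0 < q) (hαβ : ‖α * β‖ = q)
    (h : ∀ μ : ℕ, 2 ≤ μ → ‖α ^ (2 * μ) + β ^ (2 * μ)‖ ≤ B * q ^ μ + 1) (hq1 : 1 ≤ q) :
    ‖α‖ ^ 2 ≤ q := by
  by_contra hlt
  push Not at hlt
  set r := ‖α‖ ^ 2 / q with hr
  have hr1 : 1 < r := by rw [hr, one_lt_div hq]; exact hlt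
  obtain ⟨n, hn⟩ := pow_unbounded_of_one_lt (B + 2) hr1
  have hα2 : ‖α‖ ^ 2 = r * q := by rw [hr]; field_simp
  have hβ2 : ‖β‖ ^ 2 ≤ q := by
    rw [norm_mul] at hαβ
    have : ‖α‖ ^ 2 * ‖β‖ ^ 2 = q * q := by rw [← mul_pow, hαβ]; ring
    by_contra hc
    push Not at hc
    nlinarith
  have hμ := h (n + 2) (by omega)
  have h1 : ‖α ^ (2 * (n + 2))‖ = r ^ (n + 2) * q ^ (n + 2) := by
    rw [norm_pow, pow_mul, hα2, mul_pow]
  have h2 : ‖β ^ (2 * (n + 2))‖ ≤ q ^ (n + 2) := by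
    rw [norm_pow, pow_mul]
    exact pow_le_pow_left₀ (by positivity) hβ2 _
  have h3 : ‖α ^ (2 * (n + 2))‖ ≤ ‖α ^ (2 * (n + 2)) + β ^ (2 * (n + 2))‖ + ‖β ^ (2 * (n + 2))‖ := by
    have := norm_sub_le (α ^ (2 * (n + 2)) + β ^ (2 * (n + 2))) (β ^ (2 * (n + 2)))
    rwa [add_sub_cancel_right] at this
  have h4 : r ^ n ≤ r ^ (n + 2) := pow_le_pow_right₀ hr1.le (by omega)
  have h5 : (1 : ℝ) ≤ q ^ (n + 2) := one_le_pow₀ hq1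
  rw [h1] at h3
  nlinarith

theorem kw_weil_prime {p : ℕ} [Fact p.Prime] (hodd : p ≠ 2) (ψ : AddChar (ZMod p) ℂ) (hψ : ψ ≠ 1)
    (b : ZMod p) (hb : b ≠ 0) :
    ‖∑ x ∈ Finset.univ.filter (fun x : ZMod p => x ≠ 0), ψ (x + b * x⁻¹)‖ ≤ 2 * Real.sqrt p := by
  classical
  have hprime : p.Prime := Fact.out
  rw [← kwA_one]
  set K := kwA ψ b 1 with hK
  obtain ⟨s, hs⟩ := IsAlgClosed.exists_pow_nat_eq (K ^ 2 - 4 * p) (n := 2) (by norm_num)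
  set α := (-K + s) / 2 with hα
  set β := (-K - s) / 2 with hβ
  have h1 : α + β = -K := by rw [hα, hβ]; ring
  have h2 : α * β = p := by rw [hα, hβ]; linear_combination -hs / 4
  have hp0 : (0 : ℝ) < p := by exact_mod_cast hprime.pos
  have hp1 : (1 : ℝ) ≤ p := by exact_mod_cast hprime.one_lt.le
  have hbound : ∀ μ : ℕ, 2 ≤ μ → ‖α ^ (2 * μ) + β ^ (2 * μ)‖ ≤ (3 * p : ℝ) * (p : ℝ) ^ μ + 1 := by
    intro μ hμ
    let F := GaloisField p (2 * μ)
    let : Fintype F := Fintype.ofFinite F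
    have hfr : Module.finrank (ZMod p) F = 2 * μ := GaloisField.finrank p (by omega)
    have hcard : Fintype.card F = (p ^ μ) ^ 2 := by
      rw [Module.card_eq_pow_finrank (K := ZMod p), hfr, ZMod.card, ← pow_mul, mul_comm]
    have hKF := kwK_field (F := F) ψ b
    rw [hfr] at hKF
    have hform := kwK_formula ψ b hψ hb α β h1 (by rw [h2, ZMod.card]) (2 * μ - 1)
    rw [show 2 * μ - 1 + 1 = 2 * μ by omega] at hform
    let Ψ : AddChar F ℂ := ψ.compAddMonoidHom (Algebra.trace (ZMod p) F).toAddMonoidHom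
    have hΨ : ∀ y, Ψ y = ψ (Algebra.trace (ZMod p) F y) := fun y => rfl
    have hΨ1 : Ψ ≠ 1 := by
      intro h
      apply hψ
      ext t
      obtain ⟨y, rfl⟩ := Algebra.trace_surjective (ZMod p) F t
      rw [← hΨ, h]; rfl
    have hfrob : ∀ y : F, Ψ (y ^ p - y) = 1 := by
      intro y
      rw [hΨ, map_sub]
      have : Algebra.trace (ZMod p) F (y ^ p) = Algebra.trace (ZMod p) F y := by
        have := Algebra.trace_eq_of_algEquiv (FiniteField.frobeniusAlgEquiv (ZMod p) F p) y
        simpa using this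
      rw [this, sub_self, AddChar.map_zero_eq_one]
    have := kw_char_bound (F := F) (b := algebraMap (ZMod p) F b) hprime hodd
      (by simpa using hb) μ hμ hcard Ψ hΨ1 hfrob
    rw [← norm_neg, ← hform, hKF]
    exact this
  have hαn := kw_norm_le_of_pow hp0 (by rw [h2]; simp) hbound hp1
  have hβn := kw_norm_le_of_pow hp0 (by rw [mul_comm, h2]; simp)
    (fun μ hμ => by rw [add_comm]; exact hbound μ hμ) hp1
  have e1 := Real.le_sqrt_of_sq_le hαn
  have e2 := Real.le_sqrt_of_sq_le hβn
  rw [← norm_neg, ← h1]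
  exact (norm_add_le _ _).trans (by linarith)

end KWPoly


section PP
variable {R : Type*} [CommRing R] [Fintype R] [DecidableEq R]

theorem kw_step1 (ψ : AddChar R ℂ) (hψ : ψ.IsPrimitive) (a b ε : R) (hε : ε * ε = 0) :
    ∑ u : Rˣ, ψ (a * u + b * (u⁻¹ : Rˣ)) =
      ∑ u ∈ Finset.univ.filter (fun u : Rˣ => ε * (a * u - b * (u⁻¹ : Rˣ)) = 0),
        ψ (a * u + b * (u⁻¹ : Rˣ)) := by
  have hR : (Fintype.card R : ℂ) ≠ 0 := by
    exact_mod_cast Fintype.card_ne_zero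
  apply mul_left_cancel₀ hR
  have h1 : ∀ v : R, ∑ u : Rˣ, ψ (a * u + b * (u⁻¹ : Rˣ)) =
      ∑ u : Rˣ, ψ (a * u + b * (u⁻¹ : Rˣ)) * ψ (v * (ε * (a * u - b * (u⁻¹ : Rˣ)))) := by
    intro v
    let t : Rˣ := ⟨1 + ε * v, 1 - ε * v, by linear_combination (-v * v) * hε,
      by linear_combination (-v * v) * hε⟩
    rw [← Equiv.sum_comp (Equiv.mulRight t)]
    refine Finset.sum_congr rfl fun u _ => ?_
    rw [← AddChar.map_add_eq_mul]
    congr 1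
    have e1 : ((u * t : Rˣ) : R) = u * (1 + ε * v) := rfl
    have e2 : (((u * t)⁻¹ : Rˣ) : R) = (u⁻¹ : Rˣ) * (1 - ε * v) := by
      rw [mul_inv]; rfl
    simp only [Equiv.coe_mulRight]
    rw [e1, e2]
    ring
  calc (Fintype.card R : ℂ) * ∑ u : Rˣ, ψ (a * u + b * (u⁻¹ : Rˣ))
      = ∑ v : R, ∑ u : Rˣ, ψ (a * u + b * (u⁻¹ : Rˣ)) * ψ (v * (ε * (a * u - b * (u⁻¹ : Rˣ)))) := by
        rw [← Finset.sum_congr rfl (fun v _ => h1 v)]; simp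
    _ = ∑ u : Rˣ, ψ (a * u + b * (u⁻¹ : Rˣ)) *
          ∑ v : R, ψ (v * (ε * (a * u - b * (u⁻¹ : Rˣ)))) := by
        rw [Finset.sum_comm]; simp only [Finset.mul_sum]
    _ = _ := by
        rw [Finset.sum_filter, Finset.mul_sum]
        refine Finset.sum_congr rfl fun u _ => ?_
        rw [AddChar.sum_mulShift _ hψ]
        split_ifs <;> simp [mul_comm]

theorem kw_gauss (ψ : AddChar R ℂ) (hψ : ψ.IsPrimitive) (s t : R) :
    ‖∑ w : R, ψ (s * w + t * w ^ 2)‖ ^ 2 ≤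
      Fintype.card R * (Finset.univ.filter fun h : R => 2 * t * h = 0).card := by
  have h1 : (∑ w : R, ψ (s * w + t * w ^ 2)) * (starRingEnd ℂ) (∑ w : R, ψ (s * w + t * w ^ 2)) =
      ∑ h : R, ψ (s * h + t * h ^ 2) * ∑ w : R, ψ (w * (2 * t * h)) := by
    rw [map_sum, Finset.sum_mul_sum, Finset.sum_comm]
    simp only [Finset.mul_sum]
    rw [Finset.sum_comm (s := Finset.univ (α := R)) (t := Finset.univ (α := R))
      (f := fun h w => ψ (s * h + t * h ^ 2) * ψ (w * (2 * t * h)))]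
    refine Finset.sum_congr rfl fun w _ => ?_
    rw [← Equiv.sum_comp (Equiv.addRight w)]
    refine Finset.sum_congr rfl fun h _ => ?_
    rw [← AddChar.map_neg_eq_conj, ← AddChar.map_add_eq_mul, ← AddChar.map_add_eq_mul]
    congr 1
    simp only [Equiv.coe_addRight]
    ring
  have h2 : ((‖∑ w : R, ψ (s * w + t * w ^ 2)‖ ^ 2 : ℝ) : ℂ) =
      ∑ h ∈ Finset.univ.filter (fun h : R => 2 * t * h = 0),
        ψ (s * h + t * h ^ 2) * Fintype.card R := by
    rw [Complex.ofReal_pow, ← Complex.mul_conj', h1, Finset.sum_filter]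
    refine Finset.sum_congr rfl fun h _ => ?_
    rw [AddChar.sum_mulShift _ hψ]
    split_ifs <;> simp
  have h3 := congrArg norm h2
  rw [Complex.norm_real, Real.norm_of_nonneg (by positivity)] at h3
  rw [h3]
  refine (norm_sum_le _ _).trans ?_
  simp [mul_comm]

theorem kw_step2 (ψ : AddChar R ℂ) (hψ : ψ.IsPrimitive) (a b ε δ : R) (hδ : δ ^ 3 = 0)
    (hεδ : ε * δ = 0) (B : ℝ) (hB0 : 0 ≤ B)
    (hB : ∀ u : Rˣ, ((Finset.univ.filter fun h : R => 2 * (δ ^ 2 * (b * u)) * h = 0).card : ℝ) ≤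
      Fintype.card R * B ^ 2) :
    ‖∑ u ∈ Finset.univ.filter (fun u : Rˣ => ε * (a * u - b * (u⁻¹ : Rˣ)) = 0),
        ψ (a * u + b * (u⁻¹ : Rˣ))‖ ≤
      (Finset.univ.filter (fun u : Rˣ => ε * (a * u - b * (u⁻¹ : Rˣ)) = 0)).card * B := by
  set U := Finset.univ.filter (fun u : Rˣ => ε * (a * u - b * (u⁻¹ : Rˣ)) = 0) with hU
  have hR0 : (0 : ℝ) < Fintype.card R := by exact_mod_cast Fintype.card_pos
  have h1 : ∀ w : R, ∑ u ∈ U, ψ (a * u + b * (u⁻¹ : Rˣ)) =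
      ∑ u ∈ U, ψ (a * u + b * (u⁻¹ : Rˣ)) *
        ψ ((δ * (a * u - b * (u⁻¹ : Rˣ))) * w + (δ ^ 2 * (b * (u⁻¹ : Rˣ))) * w ^ 2) := by
    intro w
    let t : Rˣ := ⟨1 + δ * w, 1 - δ * w + δ ^ 2 * w ^ 2, by linear_combination (w ^ 3) * hδ,
      by linear_combination (w ^ 3) * hδ⟩
    rw [hU, Finset.sum_filter, Finset.sum_filter, ← Equiv.sum_comp (Equiv.mulRight t)]
    refine Finset.sum_congr rfl fun u _ => ?_
    have e1 : ((u * t : Rˣ) : R) = u * (1 + δ * w) := rfl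
    have e2 : (((u * t)⁻¹ : Rˣ) : R) = (u⁻¹ : Rˣ) * (1 - δ * w + δ ^ 2 * w ^ 2) := by
      rw [mul_inv]; rfl
    have hc : ε * (a * (u * (1 + δ * w)) - b * ((u⁻¹ : Rˣ) * (1 - δ * w + δ ^ 2 * w ^ 2))) =
        ε * (a * u - b * (u⁻¹ : Rˣ)) := by
      linear_combination (a * u * w + b * (u⁻¹ : Rˣ) * w - b * (u⁻¹ : Rˣ) * δ * w ^ 2) * hεδ
    refine if_congr (by rw [Equiv.coe_mulRight, e1, e2, hc]) ?_ rfl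
    rw [Equiv.coe_mulRight, e1, e2, ← AddChar.map_add_eq_mul]
    congr 1
    ring
  have h2 : (Fintype.card R : ℂ) * ∑ u ∈ U, ψ (a * u + b * (u⁻¹ : Rˣ)) =
      ∑ u ∈ U, ψ (a * u + b * (u⁻¹ : Rˣ)) *
        ∑ w : R, ψ ((δ * (a * u - b * (u⁻¹ : Rˣ))) * w + (δ ^ 2 * (b * (u⁻¹ : Rˣ))) * w ^ 2) := by
    simp only [Finset.mul_sum]
    rw [Finset.sum_comm, ← Finset.sum_congr rfl (fun w _ => h1 w), ← Finset.mul_sum]; simp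
  have h3 : (Fintype.card R : ℝ) * ‖∑ u ∈ U, ψ (a * u + b * (u⁻¹ : Rˣ))‖ ≤
      Fintype.card R * (U.card * B) := by
    have := congrArg norm h2
    rw [norm_mul, Complex.norm_natCast] at this
    rw [this]
    refine (norm_sum_le _ _).trans ?_
    calc _ ≤ ∑ u ∈ U, (Fintype.card R : ℝ) * B := by
          refine Finset.sum_le_sum fun u _ => ?_
          rw [norm_mul, AddChar.norm_apply, one_mul]
          refine abs_le_of_sq_le_sq' ?_ (by positivity) |>.2
          refine (kw_gauss ψ hψ _ _).trans ?_
          have := hB u⁻¹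
          nlinarith
      _ = _ := by rw [Finset.sum_const, nsmul_eq_mul]; ring
  exact le_of_mul_le_mul_left h3 hR0

end PP

section PP2

theorem kw_card_ann (N : ℕ) [NeZero N] (d : ℕ) (hd : 0 < d) (c : ZMod N) (hc : IsUnit c) :
    (Finset.univ.filter fun h : ZMod N => c * (d : ZMod N) * h = 0).card ≤ d := by
  have := IsAddCyclic.card_nsmul_eq_zero_le (α := ZMod N) hd
  refine le_trans (Finset.card_le_card ?_) this
  intro h hh
  simp only [Finset.mem_filter, Finset.mem_univ, true_and] at hh ⊢
  rw [nsmul_eq_mul]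
  rw [mul_assoc] at hh
  exact (hc.mul_right_eq_zero).1 hh

theorem kw_dich (p k : ℕ) (hp : p.Prime) (y : ZMod (p ^ k)) :
    IsUnit y ∨ (p : ZMod (p ^ k)) ∣ y := by
  have : NeZero (p ^ k) := ⟨pow_ne_zero _ hp.ne_zero⟩
  rw [← ZMod.natCast_zmod_val y, ZMod.isUnit_iff_coprime]
  by_cases h : p ∣ y.val
  · right; exact_mod_cast Nat.cast_dvd_cast (α := ZMod (p ^ k)) h
  · left
    exact ((hp.coprime_iff_not_dvd.2 h).symm).pow_right k

theorem kw_notUnit (p k : ℕ) (hp : p.Prime) (hk : k ≠ 0) (y : ZMod (p ^ k)) (hy : IsUnit y) :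
    ¬ (p : ZMod (p ^ k)) ∣ y := by
  intro h
  have h1 : IsUnit (p : ZMod (p ^ k)) := isUnit_of_dvd_unit h hy
  rw [ZMod.isUnit_iff_coprime, Nat.coprime_pow_right_iff (Nat.pos_of_ne_zero hk)] at h1
  rw [Nat.coprime_self] at h1
  exact hp.one_lt.ne' h1

theorem kw_card_X (p k r : ℕ) (hp : p.Prime) (hrk : r < k) (a b : ZMod (p ^ k))
    (hab : IsUnit a ∨ IsUnit b) [NeZero (p ^ k)] :
    (Finset.univ.filter (fun u : (ZMod (p ^ k))ˣ =>
      ((p ^ r : ℕ) : ZMod (p ^ k)) * (a * u - b * (u⁻¹ : (ZMod (p ^ k))ˣ)) = 0)).card ≤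
      2 * (if p = 2 then p ^ (r + 1) else p ^ r) ∧
    (¬ IsUnit b → (Finset.univ.filter (fun u : (ZMod (p ^ k))ˣ =>
      ((p ^ r : ℕ) : ZMod (p ^ k)) * (a * u - b * (u⁻¹ : (ZMod (p ^ k))ˣ)) = 0)).card = 0) := by
  classical
  have hk : k ≠ 0 := by omega
  set ε : ZMod (p ^ k) := ((p ^ r : ℕ) : ZMod (p ^ k)) with hε
  have hε0 : ε ≠ 0 := by
    rw [hε, Ne, ZMod.natCast_eq_zero_iff, Nat.pow_dvd_pow_iff_le_right hp.one_lt]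
    omega
  set U := Finset.univ.filter (fun u : (ZMod (p ^ k))ˣ =>
      ε * (a * u - b * (u⁻¹ : (ZMod (p ^ k))ˣ)) = 0) with hU
  have hmem : ∀ u, u ∈ U ↔ ε * (a * u - b * (u⁻¹ : (ZMod (p ^ k))ˣ)) = 0 := by
    intro u; simp [hU]
  have hnu : ∀ u ∈ U, (p : ZMod (p ^ k)) ∣ (a * u - b * (u⁻¹ : (ZMod (p ^ k))ˣ)) := by
    intro u hu
    rw [hmem] at hu
    refine (kw_dich p k hp _).resolve_left fun h => hε0 ?_
    exact (h.mul_left_eq_zero).1 hu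
  have hboth : ∀ u ∈ U, IsUnit a ∧ IsUnit b := by
    intro u hu
    have h1 := hnu u hu
    rcases hab with ha | hb
    · refine ⟨ha, (kw_dich p k hp b).resolve_right fun h => ?_⟩
      have h2 := dvd_add h1 (h.mul_right ((u⁻¹ : (ZMod (p ^ k))ˣ) : ZMod (p ^ k)))
      rw [sub_add_cancel] at h2
      exact kw_notUnit p k hp hk _ (ha.mul u.isUnit) h2
    · refine ⟨(kw_dich p k hp a).resolve_right fun h => ?_, hb⟩
      have h2 := dvd_sub (h.mul_right (u : ZMod (p ^ k))) h1
      rw [sub_sub_cancel] at h2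
      exact kw_notUnit p k hp hk _ (hb.mul (u⁻¹).isUnit) h2
  refine ⟨?_, ?_⟩
  · rcases U.eq_empty_or_nonempty with h0 | ⟨x0, hx0⟩
    · simp [h0]
    obtain ⟨ha, hb⟩ := hboth x0 hx0
    set d := if p = 2 then p ^ (r + 1) else p ^ r with hd
    have hdpos : 0 < d := by rw [hd]; split_ifs <;> exact pow_pos hp.pos _
    have hcl : ∀ x ∈ U, (d : ZMod (p ^ k)) * ((x : ZMod (p ^ k)) - x0) = 0 ∨
        (d : ZMod (p ^ k)) * ((x : ZMod (p ^ k)) + x0) = 0 := by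
      intro x hx
      have e0 := (hmem x0).1 hx0
      have e1 := (hmem x).1 hx
      have i0 : (x0 : ZMod (p ^ k)) * (x0⁻¹ : (ZMod (p ^ k))ˣ) = 1 := by simp
      have i1 : (x : ZMod (p ^ k)) * (x⁻¹ : (ZMod (p ^ k))ˣ) = 1 := by simp
      have key : ε * (((x : ZMod (p ^ k)) - x0) * (x + x0)) = 0 := by
        refine (ha.mul_right_eq_zero).1 ?_
        linear_combination (x : ZMod (p ^ k)) * e1 - (x0 : ZMod (p ^ k)) * e0 + ε * b * i1 - ε * b * i0
      by_cases h2 : p = 2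
      · subst h2
        rw [hd, if_pos rfl]
        have hoddsum : ∀ y z : (ZMod (2 ^ k))ˣ, ((2 : ℕ) : ZMod (2 ^ k)) ∣ (y : ZMod (2 ^ k)) - z := by
          intro y z
          have hodd : ∀ y : (ZMod (2 ^ k))ˣ, ∃ t, (y : ZMod (2 ^ k)) = 1 + ((2 : ℕ) : ZMod (2 ^ k)) * t := by
            intro y
            have hv := (ZMod.isUnit_iff_coprime (y : ZMod (2 ^ k)).val (2 ^ k)).1
              (by rw [ZMod.natCast_zmod_val]; exact y.isUnit)
            rw [Nat.coprime_pow_right_iff (Nat.pos_of_ne_zero hk), Nat.coprime_two_right] at hv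
            obtain ⟨t, ht⟩ := hv
            refine ⟨t, ?_⟩
            rw [← ZMod.natCast_zmod_val (y : ZMod (2 ^ k)), ht]
            push_cast; ring
          obtain ⟨s, hs⟩ := hodd y
          obtain ⟨t, ht⟩ := hodd z
          exact ⟨s - t, by rw [hs, ht]; ring⟩
        obtain ⟨s, hs⟩ := hoddsum x x0
        have hs' : (x : ZMod (2 ^ k)) + x0 = ((2 : ℕ) : ZMod (2 ^ k)) * (s + x0) := by
          push_cast at hs ⊢
          linear_combination hs
        have hs1 : IsUnit s ∨ IsUnit (s + x0) := by
          by_contra hcon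
          push Not at hcon
          have h1 := (kw_dich 2 k hp s).resolve_left hcon.1
          have h2 := (kw_dich 2 k hp (s + x0)).resolve_left hcon.2
          have h3 := dvd_sub h2 h1
          rw [add_sub_cancel_left] at h3
          exact kw_notUnit 2 k hp hk _ x0.isUnit h3
        have hpow : ((2 ^ (r + 1) : ℕ) : ZMod (2 ^ k)) = ε * ((2 : ℕ) : ZMod (2 ^ k)) := by
          rw [hε]; push_cast; ring
        rw [hpow]
        rcases hs1 with h | h
        · right
          refine (h.mul_right_eq_zero).1 ?_
          rw [hs] at key
          linear_combination key
        · left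
          refine (h.mul_right_eq_zero).1 ?_
          rw [hs'] at key
          linear_combination key
      · rw [hd, if_neg h2, ← hε]
        have h2u : IsUnit (2 : ZMod (p ^ k)) := by
          have := (ZMod.isUnit_iff_coprime 2 (p ^ k)).2
            (((Nat.coprime_primes Nat.prime_two hp).2 (Ne.symm h2)).pow_right k)
          exact_mod_cast this
        have hs1 : IsUnit ((x : ZMod (p ^ k)) - x0) ∨ IsUnit ((x : ZMod (p ^ k)) + x0) := by
          by_contra hcon
          push Not at hcon
          have h1 := (kw_dich p k hp _).resolve_left hcon.1
          have h2 := (kw_dich p k hp _).resolve_left hcon.2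
          have h3 := dvd_add h2 h1
          have e : (x : ZMod (p ^ k)) + x0 + (x - x0) = 2 * x := by ring
          rw [e] at h3
          exact kw_notUnit p k hp hk _ (h2u.mul x.isUnit) h3
        rcases hs1 with h | h
        · right
          refine (h.mul_right_eq_zero).1 ?_
          linear_combination key
        · left
          refine (h.mul_right_eq_zero).1 ?_
          linear_combination key
    have hA := kw_card_ann (p ^ k) d hdpos 1 isUnit_one
    set A := Finset.univ.filter fun h : ZMod (p ^ k) => 1 * (d : ZMod (p ^ k)) * h = 0 with hAdef
    have hsub : U.image (fun x : (ZMod (p ^ k))ˣ => (x : ZMod (p ^ k))) ⊆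
        A.image (fun y => y + (x0 : ZMod (p ^ k))) ∪ A.image (fun y => y - (x0 : ZMod (p ^ k))) := by
      intro y hy
      rw [Finset.mem_image] at hy
      obtain ⟨x, hx, rfl⟩ := hy
      rw [Finset.mem_union, Finset.mem_image, Finset.mem_image]
      rcases hcl x hx with h | h
      · left
        exact ⟨x - x0, by simp [hAdef, h], by ring⟩
      · right
        exact ⟨x + x0, by simp [hAdef, h], by ring⟩
    rw [← Finset.card_image_of_injective U (f := fun x : (ZMod (p ^ k))ˣ => (x : ZMod (p ^ k)))
      (fun x y h => Units.ext h)]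
    refine (Finset.card_le_card hsub).trans ((Finset.card_union_le _ _).trans ?_)
    have i1 := Finset.card_image_le (s := A) (f := fun y => y + (x0 : ZMod (p ^ k)))
    have i2 := Finset.card_image_le (s := A) (f := fun y => y - (x0 : ZMod (p ^ k)))
    omega
  · intro hb
    rw [Finset.card_eq_zero, Finset.eq_empty_iff_forall_notMem]
    intro u hu
    exact hb (hboth u hu).2

end PP2


section Final

/-- Kloosterman sum modulo `N`. -/
noncomputable def kwS (N : ℕ) [NeZero N] (a b : ZMod N) : ℂ :=
  ∑ u : (ZMod N)ˣ, (ZMod.stdAddChar (N := N) (a * (u : ZMod N) + b * ((u⁻¹ : (ZMod N)ˣ) : ZMod N)) : ℂ)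

theorem kwS_trivial (N : ℕ) [NeZero N] (a b : ZMod N) : ‖kwS N a b‖ ≤ N := by
  refine (norm_sum_le _ _).trans ?_
  simp only [AddChar.norm_apply, Finset.sum_const, Finset.card_univ, nsmul_eq_mul, mul_one]
  rw [ZMod.card_units_eq_totient]
  exact_mod_cast Nat.totient_le N

theorem kwS_swap (N : ℕ) [NeZero N] (a b : ZMod N) : kwS N a b = kwS N b a := by
  unfold kwS
  rw [← Equiv.sum_comp (Equiv.inv (ZMod N)ˣ)]
  refine Finset.sum_congr rfl fun u _ => ?_
  simp only [Equiv.inv_apply, inv_inv]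
  rw [add_comm]

theorem kw_sum_units (p : ℕ) [Fact p.Prime] (f : ZMod p → ℂ) :
    ∑ u : (ZMod p)ˣ, f u = ∑ x ∈ Finset.univ.filter (fun x : ZMod p => x ≠ 0), f x := by
  refine Finset.sum_bij (fun u _ => (u : ZMod p)) ?_ ?_ ?_ ?_
  · intro u _; simp
  · intro u _ v _ h; exact Units.ext h
  · intro x hx
    exact ⟨Units.mk0 x (Finset.mem_filter.1 hx).2, Finset.mem_univ _, rfl⟩
  · intro u _; rfl

theorem kwS_prime_zero (p : ℕ) [Fact p.Prime] (a : ZMod p) (ha : a ≠ 0) :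
    ‖kwS p a 0‖ ≤ 2 * Real.sqrt p := by
  have hprime : p.Prime := Fact.out
  have hp1 : (1 : ℝ) ≤ Real.sqrt p := by
    rw [Real.one_le_sqrt]; exact_mod_cast hprime.one_lt.le
  have h1 : kwS p a 0 = -1 := by
    unfold kwS
    simp only [zero_mul, add_zero]
    rw [kw_sum_units p (fun x => ZMod.stdAddChar (a * x))]
    have h := AddChar.sum_mulShift a (ZMod.isPrimitive_stdAddChar p)
    rw [if_neg ha] at h
    have hsplit := Finset.sum_filter_add_sum_filter_not (Finset.univ : Finset (ZMod p))
      (fun x => x ≠ 0) (fun x => (ZMod.stdAddChar (a * x) : ℂ))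
    have h2 : Finset.univ.filter (fun x : ZMod p => ¬ x ≠ 0) = {0} := by
      ext x; simp
    rw [h2, Finset.sum_singleton, mul_zero, AddChar.map_zero_eq_one] at hsplit
    simp only [mul_comm _ a] at h
    rw [h] at hsplit
    push_cast at hsplit
    linear_combination hsplit
  rw [h1, norm_neg, norm_one]
  linarith

theorem kwS_prime (p : ℕ) [Fact p.Prime] (hodd : p ≠ 2) (a b : ZMod p) (hab : a ≠ 0 ∨ b ≠ 0) :
    ‖kwS p a b‖ ≤ 2 * Real.sqrt p := by
  by_cases hb : b = 0
  · subst hb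
    exact kwS_prime_zero p a (by simpa using hab)
  by_cases ha : a = 0
  · subst ha
    rw [kwS_swap]
    exact kwS_prime_zero p b hb
  have hψ : (ZMod.stdAddChar (N := p)) ≠ 1 := by
    intro h
    have := ZMod.isPrimitive_stdAddChar p one_ne_zero
    rw [h] at this
    exact this (by ext; simp)
  have h := kw_weil_prime hodd (ZMod.stdAddChar (N := p)) hψ (a * b) (mul_ne_zero ha hb)
  rw [← kw_sum_units p (fun x => ZMod.stdAddChar (x + a * b * x⁻¹))] at h
  have e : kwS p a b = ∑ u : (ZMod p)ˣ, ZMod.stdAddChar ((u : ZMod p) + a * b * (u : ZMod p)⁻¹) := by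
    unfold kwS
    symm
    rw [← Equiv.sum_comp (Equiv.mulLeft (Units.mk0 a ha))]
    refine Finset.sum_congr rfl fun u _ => ?_
    congr 1
    simp only [Equiv.coe_mulLeft, Units.val_mul, Units.val_mk0, Units.val_inv_eq_inv_val]
    field_simp
  rw [e]
  exact h

/-- weight -/
noncomputable def kwW (p : ℕ) : ℝ := if 2 ∣ p then 8 else 1

theorem kw_pp_unit (p k : ℕ) (hp : p.Prime) (hk : 1 ≤ k) [NeZero (p ^ k)] (a b : ZMod (p ^ k))
    (hab : IsUnit a ∨ IsUnit b) :
    ‖kwS (p ^ k) a b‖ ≤ kwW p * (2 * Real.sqrt ((p ^ k : ℕ) : ℝ)) := by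
  have hp0 : (0 : ℝ) < p := by exact_mod_cast hp.pos
  rcases eq_or_lt_of_le hk with h1 | hk2
  · -- prime modulus
    subst h1
    have hN : (p ^ 1).Prime := by simpa using hp
    have : Fact (p ^ 1).Prime := ⟨hN⟩
    by_cases h2 : p = 2
    · refine (kwS_trivial _ a b).trans ?_
      subst h2
      have : (1 : ℝ) ≤ Real.sqrt ((2 ^ 1 : ℕ) : ℝ) := by rw [Real.one_le_sqrt]; norm_num
      rw [kwW, if_pos (dvd_refl _)]
      push_cast at this ⊢
      linarith
    · have hw : kwW p = 1 := by
        rw [kwW, if_neg]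
        intro h; exact h2 ((Nat.prime_dvd_prime_iff_eq Nat.prime_two hp).1 h).symm
      rw [hw, one_mul]
      exact kwS_prime (p ^ 1) (by simpa using h2) a b (hab.imp IsUnit.ne_zero IsUnit.ne_zero)
  · set m := k / 2 with hm
    set r := k - m with hr
    have hrk : r < k := by omega
    have hpz : ∀ j, k ≤ j → ((p : ZMod (p ^ k))) ^ j = 0 := by
      intro j hj
      have : ((p ^ j : ℕ) : ZMod (p ^ k)) = 0 := by
        rw [ZMod.natCast_eq_zero_iff]; exact pow_dvd_pow p hj
      exact_mod_cast this
    have hε : ((p ^ r : ℕ) : ZMod (p ^ k)) * ((p ^ r : ℕ) : ZMod (p ^ k)) = 0 := by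
      push_cast
      rw [← pow_add]; exact hpz _ (by omega)
    obtain ⟨hX, hX0⟩ := kw_card_X p k r hp hrk a b hab
    have hS := kw_step1 ZMod.stdAddChar (ZMod.isPrimitive_stdAddChar (p ^ k)) a b _ hε
    rw [kwS, hS]
    set U := Finset.univ.filter (fun u : (ZMod (p ^ k))ˣ =>
      ((p ^ r : ℕ) : ZMod (p ^ k)) * (a * u - b * (u⁻¹ : (ZMod (p ^ k))ˣ)) = 0) with hU
    have htriv : ‖∑ u ∈ U, (ZMod.stdAddChar (N := p ^ k) (a * (u : ZMod (p ^ k)) +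
        b * ((u⁻¹ : (ZMod (p ^ k))ˣ) : ZMod (p ^ k))) : ℂ)‖ ≤ U.card := by
      refine (norm_sum_le _ _).trans ?_
      simp [AddChar.norm_apply]
    by_cases h2 : p = 2
    · subst h2
      rw [if_pos rfl] at hX
      rw [kwW, if_pos (dvd_refl _)]
      refine htriv.trans ?_
      have h3 : (U.card : ℝ) ≤ 4 * 2 ^ r := by
        have : (U.card : ℝ) ≤ ((2 * 2 ^ (r + 1) : ℕ) : ℝ) := by exact_mod_cast hX
        refine this.trans (le_of_eq ?_)
        push_cast; ring
      have h4 : (2 : ℝ) ^ r ≤ Real.sqrt (4 * ((2 ^ k : ℕ) : ℝ)) := by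
        apply Real.le_sqrt_of_sq_le
        rw [← pow_mul]
        push_cast
        have : (2 : ℝ) ^ (r * 2) ≤ 2 ^ (k + 2) := pow_le_pow_right₀ (by norm_num) (by omega)
        refine this.trans (le_of_eq ?_)
        ring
      have h5 : Real.sqrt (4 * ((2 ^ k : ℕ) : ℝ)) = 2 * Real.sqrt ((2 ^ k : ℕ) : ℝ) := by
        rw [Real.sqrt_mul (by norm_num), show (4 : ℝ) = 2 ^ 2 by norm_num,
          Real.sqrt_sq (by norm_num)]
      rw [h5] at h4
      have h6 := Real.sqrt_nonneg ((2 ^ k : ℕ) : ℝ)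
      linarith
    · have hw : kwW p = 1 := by
        rw [kwW, if_neg]
        intro h; exact h2 ((Nat.prime_dvd_prime_iff_eq Nat.prime_two hp).1 h).symm
      rw [hw, one_mul]
      rw [if_neg h2] at hX
      have hXr : (U.card : ℝ) ≤ 2 * (p : ℝ) ^ r := by exact_mod_cast hX
      rcases Nat.even_or_odd' k with ⟨m', hk' | hk'⟩
      · refine htriv.trans (hXr.trans ?_)
        have hrm : r = m' := by omega
        have : Real.sqrt ((p ^ k : ℕ) : ℝ) = (p : ℝ) ^ r := by
          rw [hrm, hk', mul_comm, pow_mul]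
          push_cast
          exact Real.sqrt_sq (by positivity)
        rw [this]
      · by_cases hb : IsUnit b
        · have hmm : m = m' := by omega
          have hrm : r = m' + 1 := by omega
          have hδ : ((p : ZMod (p ^ k)) ^ m') ^ 3 = 0 := by
            rw [← pow_mul]; exact hpz _ (by omega)
          have hεδ : ((p ^ r : ℕ) : ZMod (p ^ k)) * (p : ZMod (p ^ k)) ^ m' = 0 := by
            push_cast
            rw [← pow_add]; exact hpz _ (by omega)
          have h2u : IsUnit (2 : ZMod (p ^ k)) := by
            have := (ZMod.isUnit_iff_coprime 2 (p ^ k)).2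
              (((Nat.coprime_primes Nat.prime_two hp).2 (Ne.symm h2)).pow_right k)
            exact_mod_cast this
          have h := kw_step2 ZMod.stdAddChar (ZMod.isPrimitive_stdAddChar (p ^ k)) a b _ _ hδ hεδ
            (1 / Real.sqrt p) (by positivity) (by
              intro u
              have hc := kw_card_ann (p ^ k) (p ^ (2 * m')) (pow_pos hp.pos _) (2 * (b * u))
                (h2u.mul (hb.mul u.isUnit))
              have e : (Finset.univ.filter fun h : ZMod (p ^ k) =>
                  2 * (((p : ZMod (p ^ k)) ^ m') ^ 2 * (b * u)) * h = 0) =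
                  Finset.univ.filter fun h : ZMod (p ^ k) =>
                  2 * (b * u) * ((p ^ (2 * m') : ℕ) : ZMod (p ^ k)) * h = 0 := by
                refine Finset.filter_congr fun h _ => ?_
                have : 2 * (((p : ZMod (p ^ k)) ^ m') ^ 2 * (b * u)) * h =
                    2 * (b * u) * ((p ^ (2 * m') : ℕ) : ZMod (p ^ k)) * h := by
                  push_cast; ring
                rw [this]
              rw [e, ZMod.card, div_pow, Real.sq_sqrt hp0.le, one_pow]
              have hc' : ((Finset.univ.filter fun h : ZMod (p ^ k) =>
                  2 * (b * u) * ((p ^ (2 * m') : ℕ) : ZMod (p ^ k)) * h = 0).card : ℝ) ≤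
                  ((p ^ (2 * m') : ℕ) : ℝ) := by exact_mod_cast hc
              refine hc'.trans (le_of_eq ?_)
              have hpk : (p : ℝ) ^ k = (p : ℝ) ^ (2 * m') * p := by
                rw [← pow_succ]; congr 1
              push_cast
              rw [hpk]
              field_simp)
          refine h.trans ?_
          have hsq : Real.sqrt ((p ^ k : ℕ) : ℝ) = (p : ℝ) ^ m' * Real.sqrt p := by
            have hpk : ((p ^ k : ℕ) : ℝ) = ((p : ℝ) ^ m') ^ 2 * p := by
              push_cast
              rw [← pow_mul, ← pow_succ]; congr 1; omega
            rw [hpk, Real.sqrt_mul (by positivity), Real.sqrt_sq (by positivity)]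
          have hsp : 0 < Real.sqrt p := Real.sqrt_pos.2 hp0
          rw [hsq, mul_one_div, div_le_iff₀ hsp]
          have : 2 * ((p : ℝ) ^ m' * Real.sqrt p) * Real.sqrt p = 2 * (p : ℝ) ^ r := by
            rw [hrm, pow_succ]
            linear_combination 2 * (p : ℝ) ^ m' * Real.mul_self_sqrt hp0.le
          rw [this]
          exact hXr
        · have h0 := hX0 hb
          rw [h0] at htriv
          refine htriv.trans ?_
          push_cast
          positivity

theorem kw_fiber {G H : Type*} [Group G] [Group H] [Fintype G] [Fintype H] (φ : G →* H)
    (hφ : Function.Surjective φ) :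
    ∃ c : ℕ, c * Fintype.card H = Fintype.card G ∧
      ∀ f : H → ℂ, ∑ u : G, f (φ u) = c * ∑ v : H, f v := by
  classical
  refine ⟨(Finset.univ.filter fun g : G => φ g = 1).card, ?_, ?_⟩
  · have h := Finset.card_eq_sum_card_fiberwise (f := φ) (s := Finset.univ) (t := Finset.univ) (by simp)
    rw [Finset.sum_congr rfl (fun v _ => MonoidHom.card_fiber_eq_of_mem_range φ (hφ v) (hφ 1))] at h
    rw [Finset.sum_const, smul_eq_mul, Finset.card_univ, Finset.card_univ] at h
    rw [h, mul_comm]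
  · intro f
    rw [← Finset.sum_fiberwise_of_maps_to (s := Finset.univ) (t := Finset.univ) (g := φ) (by simp),
      Finset.mul_sum]
    refine Finset.sum_congr rfl fun v _ => ?_
    rw [← MonoidHom.card_fiber_eq_of_mem_range φ (hφ v) (hφ 1), ← nsmul_eq_mul, ← Finset.sum_const]
    refine Finset.sum_congr rfl fun u hu => ?_
    rw [(Finset.mem_filter.1 hu).2]

theorem kw_char_red (d M N : ℕ) [NeZero M] [NeZero N] (hN : N = d * M) (h : M ∣ N) (t : ZMod N) :
    ZMod.stdAddChar ((d : ZMod N) * t) = ZMod.stdAddChar (ZMod.castHom h (ZMod M) t) := by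
  obtain ⟨z, rfl⟩ := ZMod.intCast_surjective t
  have hd : (d : ℂ) ≠ 0 := by
    have : N ≠ 0 := NeZero.ne N
    rw [hN] at this
    exact_mod_cast left_ne_zero_of_mul this
  have hM : (M : ℂ) ≠ 0 := by exact_mod_cast NeZero.ne M
  have e : (d : ZMod N) * (z : ZMod N) = ((d * z : ℤ) : ZMod N) := by push_cast; rfl
  rw [e, map_intCast (ZMod.castHom h (ZMod M)), ZMod.stdAddChar_coe, ZMod.stdAddChar_coe]
  congr 1
  rw [hN]
  push_cast
  field_simp

theorem kw_red (p i j : ℕ) (hp : p.Prime) (hi : 1 ≤ i) [NeZero (p ^ i)] [NeZero (p ^ (j + i))]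
    (a b : ℤ) :
    kwS (p ^ (j + i)) ((p ^ j * a : ℤ) : ZMod (p ^ (j + i))) ((p ^ j * b : ℤ) : ZMod (p ^ (j + i))) =
      (p : ℂ) ^ j * kwS (p ^ i) a b := by
  have hdvd : p ^ i ∣ p ^ (j + i) := pow_dvd_pow p (by omega)
  obtain ⟨c, hc, hf⟩ := kw_fiber (ZMod.unitsMap hdvd) (ZMod.unitsMap_surjective hdvd)
  have hcp : c = p ^ j := by
    rw [ZMod.card_units_eq_totient, ZMod.card_units_eq_totient] at hc
    obtain ⟨i', rfl⟩ : ∃ i', i = i' + 1 := ⟨i - 1, by omega⟩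
    rw [← add_assoc, Nat.totient_prime_pow_succ hp, Nat.totient_prime_pow_succ hp, pow_add, mul_assoc] at hc
    refine Nat.eq_of_mul_eq_mul_right ?_ hc
    exact Nat.mul_pos (pow_pos hp.pos _) (by have := hp.one_lt; omega)
  have h := hf (fun v => (ZMod.stdAddChar (N := p ^ i) ((a : ZMod (p ^ i)) * (v : ZMod (p ^ i)) + (b : ZMod (p ^ i)) * ((v⁻¹ : (ZMod (p ^ i))ˣ) : ZMod (p ^ i))) : ℂ))
  rw [hcp] at h
  push_cast at h
  unfold kwS
  rw [← h]
  refine Finset.sum_congr rfl fun u _ => ?_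
  have e : ((p ^ j * a : ℤ) : ZMod (p ^ (j + i))) * u + ((p ^ j * b : ℤ) : ZMod (p ^ (j + i))) *
      (u⁻¹ : (ZMod (p ^ (j + i)))ˣ) = ((p ^ j : ℕ) : ZMod (p ^ (j + i))) *
        ((a : ZMod (p ^ (j + i))) * u + b * (u⁻¹ : (ZMod (p ^ (j + i)))ˣ)) := by
    push_cast; ring
  rw [e, kw_char_red (p ^ j) (p ^ i) (p ^ (j + i)) (pow_add p j i) hdvd]
  congr 1
  rw [map_add, map_mul, map_mul, map_intCast, map_intCast]
  rw [← map_inv]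
  rfl

/-- the gcd -/
def kwG (a b : ℤ) (c : ℕ) : ℕ := Int.gcd a (Int.gcd b (c : ℤ))

theorem kwG_eq (a b : ℤ) (c : ℕ) : kwG a b c = Nat.gcd (Nat.gcd a.natAbs b.natAbs) c := by
  rw [Nat.gcd_assoc]; rfl

theorem kwG_mul_left (t a b : ℤ) (c : ℕ) (h : Nat.Coprime t.natAbs c) :
    kwG (t * a) (t * b) c = kwG a b c := by
  rw [kwG_eq, kwG_eq, Int.natAbs_mul, Int.natAbs_mul, Nat.gcd_mul_left, Nat.Coprime.gcd_mul_left_cancel _ h]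

theorem kwG_mul (a b : ℤ) (m n : ℕ) (h : m.Coprime n) : kwG a b (m * n) = kwG a b m * kwG a b n := by
  rw [kwG_eq, kwG_eq, kwG_eq, Nat.Coprime.gcd_mul _ h]

theorem kw_pp (p k : ℕ) (hp : p.Prime) (hk : 1 ≤ k) [NeZero (p ^ k)] (a b : ℤ) :
    ‖kwS (p ^ k) a b‖ ≤ kwW p * Real.sqrt ((p ^ k : ℕ) : ℝ) * ((k : ℝ) + 1) * Real.sqrt (kwG a b (p ^ k)) := by
  have hp0 : (0 : ℝ) < p := by exact_mod_cast hp.pos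
  have hW : 1 ≤ kwW p := by unfold kwW; split_ifs <;> norm_num
  have hk1 : (2 : ℝ) ≤ (k : ℝ) + 1 := by
    have : (1 : ℝ) ≤ k := by exact_mod_cast hk
    linarith
  have hgd : kwG a b (p ^ k) ∣ p ^ k := by rw [kwG_eq]; exact Nat.gcd_dvd_right _ _
  obtain ⟨j, hjk, hj⟩ := (Nat.dvd_prime_pow hp).1 hgd
  rw [hj]
  have hga : ((p ^ j : ℕ) : ℤ) ∣ a := by
    rw [← hj, kwG_eq, Int.natCast_dvd]
    exact (Nat.gcd_dvd_left _ _).trans (Nat.gcd_dvd_left _ _)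
  have hgb : ((p ^ j : ℕ) : ℤ) ∣ b := by
    rw [← hj, kwG_eq, Int.natCast_dvd]
    exact (Nat.gcd_dvd_left _ _).trans (Nat.gcd_dvd_right _ _)
  obtain ⟨a', rfl⟩ := hga
  obtain ⟨b', rfl⟩ := hgb
  rcases eq_or_lt_of_le hjk with rfl | hlt
  · refine (kwS_trivial _ _ _).trans ?_
    have hs : Real.sqrt ((p ^ j : ℕ) : ℝ) * Real.sqrt ((p ^ j : ℕ) : ℝ) = ((p ^ j : ℕ) : ℝ) :=
      Real.mul_self_sqrt (by positivity)
    have h0 : (0 : ℝ) ≤ ((p ^ j : ℕ) : ℝ) := by positivity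
    have h1 : (1 : ℝ) ≤ kwW p * ((j : ℝ) + 1) := by nlinarith
    calc ((p ^ j : ℕ) : ℝ) ≤ (kwW p * ((j : ℝ) + 1)) * ((p ^ j : ℕ) : ℝ) := by nlinarith
      _ = _ := by linear_combination -(kwW p * ((j : ℝ) + 1)) * hs
  · obtain ⟨i, hi, rfl⟩ : ∃ i, 1 ≤ i ∧ k = j + i := ⟨k - j, by omega, by omega⟩
    have : NeZero (p ^ i) := ⟨pow_ne_zero _ hp.ne_zero⟩
    have hred := kw_red p i j hp hi a' b'
    have e : ∀ z : ℤ, (((p ^ j : ℕ) : ℤ) * z) = (p ^ j * z : ℤ) := by intro z; push_cast; ring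
    rw [e, e, hred, norm_mul, norm_pow, Complex.norm_natCast]
    have hg1 : kwG a' b' (p ^ i) = 1 := by
      have h := hj
      rw [kwG_eq, Int.natAbs_mul, Int.natAbs_mul, Nat.gcd_mul_left, Int.natAbs_natCast, pow_add,
        Nat.gcd_mul_left] at h
      rw [kwG_eq]
      exact Nat.eq_of_mul_eq_mul_left (pow_pos hp.pos j) (by rw [h, mul_one])
    have hunit : ∀ z : ℤ, ¬ p ∣ z.natAbs → IsUnit (z : ZMod (p ^ i)) := by
      intro z hz
      rw [ZMod.coe_int_isUnit_iff_isCoprime]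
      rw [Int.isCoprime_iff_gcd_eq_one]
      have := ((hp.coprime_iff_not_dvd.2 hz).pow_left i)
      exact this
    have hab : IsUnit (a' : ZMod (p ^ i)) ∨ IsUnit (b' : ZMod (p ^ i)) := by
      by_cases h1 : p ∣ a'.natAbs
      · by_cases h2 : p ∣ b'.natAbs
        · exfalso
          have : p ∣ kwG a' b' (p ^ i) := by
            rw [kwG_eq]
            exact Nat.dvd_gcd (Nat.dvd_gcd h1 h2) (dvd_pow_self p (by omega))
          rw [hg1] at this
          exact hp.one_lt.ne' (Nat.dvd_one.1 this)
        · right; exact hunit _ h2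
      · left; exact hunit _ h1
    have hb := kw_pp_unit p i hp hi (a' : ZMod (p ^ i)) b' hab
    have hs : Real.sqrt ((p ^ (j + i) : ℕ) : ℝ) * Real.sqrt ((p ^ j : ℕ) : ℝ) =
        (p : ℝ) ^ j * Real.sqrt ((p ^ i : ℕ) : ℝ) := by
      rw [← Real.sqrt_mul (by positivity)]
      have : ((p ^ (j + i) : ℕ) : ℝ) * ((p ^ j : ℕ) : ℝ) = ((p : ℝ) ^ j) ^ 2 * ((p ^ i : ℕ) : ℝ) := by
        push_cast; ring
      rw [this, Real.sqrt_mul (by positivity), Real.sqrt_sq (by positivity)]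
    have hpj : (0 : ℝ) ≤ (p : ℝ) ^ j := by positivity
    have hsn : (0 : ℝ) ≤ Real.sqrt ((p ^ i : ℕ) : ℝ) := Real.sqrt_nonneg _
    calc (p : ℝ) ^ j * ‖kwS (p ^ i) a' b'‖
        ≤ (p : ℝ) ^ j * (kwW p * (2 * Real.sqrt ((p ^ i : ℕ) : ℝ))) :=
          mul_le_mul_of_nonneg_left hb hpj
      _ = 2 * (kwW p * ((p : ℝ) ^ j * Real.sqrt ((p ^ i : ℕ) : ℝ))) := by ring
      _ ≤ (((j + i : ℕ) : ℝ) + 1) * (kwW p * ((p : ℝ) ^ j * Real.sqrt ((p ^ i : ℕ) : ℝ))) :=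
          mul_le_mul_of_nonneg_right hk1 (by positivity)
      _ = _ := by rw [← hs]; ring

theorem kw_char_mul (m n : ℕ) [NeZero m] [NeZero n] [NeZero (m * n)] (s t : ℤ) (hst : s * m + t * n = 1)
    (x : ZMod (m * n)) :
    (ZMod.stdAddChar x : ℂ) =
      ZMod.stdAddChar ((t : ZMod m) * ZMod.castHom (dvd_mul_right m n) (ZMod m) x) *
      ZMod.stdAddChar ((s : ZMod n) * ZMod.castHom (dvd_mul_left n m) (ZMod n) x) := by
  obtain ⟨z, rfl⟩ := ZMod.intCast_surjective x
  have hm : (m : ℂ) ≠ 0 := by exact_mod_cast NeZero.ne m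
  have hn : (n : ℂ) ≠ 0 := by exact_mod_cast NeZero.ne n
  rw [map_intCast (ZMod.castHom (dvd_mul_right m n) (ZMod m)),
    map_intCast (ZMod.castHom (dvd_mul_left n m) (ZMod n)), ← Int.cast_mul, ← Int.cast_mul, ZMod.stdAddChar_coe,
    ZMod.stdAddChar_coe, ZMod.stdAddChar_coe, ← Complex.exp_add]
  congr 1
  have hc : (s : ℂ) * m + t * n = 1 := by exact_mod_cast hst
  push_cast
  field_simp
  linear_combination (-(z : ℂ)) * hc

theorem kwS_mul (m n : ℕ) [NeZero m] [NeZero n] [NeZero (m * n)] (h : m.Coprime n)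
    (s t : ℤ) (hst : s * m + t * n = 1) (a b : ℤ) :
    kwS (m * n) a b = kwS m ((t * a : ℤ) : ZMod m) ((t * b : ℤ) : ZMod m) *
      kwS n ((s * a : ℤ) : ZMod n) ((s * b : ℤ) : ZMod n) := by
  let E : (ZMod (m * n))ˣ ≃* (ZMod m)ˣ × (ZMod n)ˣ :=
    (Units.mapEquiv (ZMod.chineseRemainder h).toMulEquiv).trans MulEquiv.prodUnits
  have hE1 : ∀ u, (((E u).1 : (ZMod m)ˣ) : ZMod m) = ZMod.castHom (dvd_mul_right m n) (ZMod m) u := by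
    intro u
    have : (((E u).1 : (ZMod m)ˣ) : ZMod m) = (ZMod.chineseRemainder h u).1 := rfl
    rw [this]
    obtain ⟨z, hz⟩ := ZMod.intCast_surjective (u : ZMod (m * n))
    rw [← hz, map_intCast, map_intCast]; rfl
  have hE2 : ∀ u, (((E u).2 : (ZMod n)ˣ) : ZMod n) = ZMod.castHom (dvd_mul_left n m) (ZMod n) u := by
    intro u
    have : (((E u).2 : (ZMod n)ˣ) : ZMod n) = (ZMod.chineseRemainder h u).2 := rfl
    rw [this]
    obtain ⟨z, hz⟩ := ZMod.intCast_surjective (u : ZMod (m * n))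
    rw [← hz, map_intCast, map_intCast]; rfl
  unfold kwS
  rw [Finset.sum_mul_sum, ← Finset.sum_product', Finset.univ_product_univ,
    ← Equiv.sum_comp E.toEquiv]
  refine Finset.sum_congr rfl fun u _ => ?_
  rw [kw_char_mul m n s t hst]
  have i1 : (((E u).1⁻¹ : (ZMod m)ˣ) : ZMod m) =
      ZMod.castHom (dvd_mul_right m n) (ZMod m) (u⁻¹ : (ZMod (m * n))ˣ) := by
    rw [← hE1, map_inv]; rfl
  have i2 : (((E u).2⁻¹ : (ZMod n)ˣ) : ZMod n) =
      ZMod.castHom (dvd_mul_left n m) (ZMod n) (u⁻¹ : (ZMod (m * n))ˣ) := by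
    rw [← hE2, map_inv]; rfl
  simp only [MulEquiv.coe_toEquiv, MulEquiv.toEquiv_eq_coe, EquivLike.coe_coe]
  rw [i1, i2, hE1, hE2]
  simp only [map_add, map_mul, map_intCast, Int.cast_mul]
  congr 2 <;> ring

theorem kw_all (c : ℕ) : ∀ (_ : NeZero c) (a b : ℤ),
    ‖kwS c a b‖ ≤ kwW c * Real.sqrt c * (c.divisors.card : ℝ) * Real.sqrt (kwG a b c) := by
  induction c using Nat.recOnPosPrimePosCoprime with
  | prime_pow p n hp hn =>
    intro _ a b
    have h := kw_pp p n hp hn a b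
    have hw : kwW (p ^ n) = kwW p := by
      unfold kwW
      have : 2 ∣ p ^ n ↔ 2 ∣ p :=
        ⟨fun h => Nat.prime_two.dvd_of_dvd_pow h, fun h => h.trans (dvd_pow_self p (by omega))⟩
      simp only [this]
    rw [hw, Nat.divisors_prime_pow hp, Finset.card_map, Finset.card_range]
    push_cast at h ⊢
    exact h
  | zero => intro h; exact absurd rfl h.out
  | one =>
    intro _ a b
    refine (kwS_trivial _ _ _).trans ?_
    simp [kwW, kwG]
  | coprime m n hm hn h ihm ihn =>
    intro hmn a b
    have hm0 : NeZero m := ⟨by omega⟩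
    have hn0 : NeZero n := ⟨by omega⟩
    obtain ⟨s, t, hst⟩ := Nat.isCoprime_iff_coprime.2 h
    rw [kwS_mul m n h s t hst, norm_mul]
    have hm1 := ihm hm0 (t * a) (t * b)
    have hn1 := ihn hn0 (s * a) (s * b)
    have ct : Nat.Coprime t.natAbs m := by
      have : IsCoprime t (m : ℤ) := ⟨n, s, by linear_combination hst⟩
      exact Int.isCoprime_iff_gcd_eq_one.1 this
    have cs : Nat.Coprime s.natAbs n := by
      have : IsCoprime s (n : ℤ) := ⟨m, t, by linear_combination hst⟩
      exact Int.isCoprime_iff_gcd_eq_one.1 this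
    rw [kwG_mul_left _ _ _ _ ct] at hm1
    rw [kwG_mul_left _ _ _ _ cs] at hn1
    have hW : kwW (m * n) = kwW m * kwW n := by
      unfold kwW
      have h12 : ¬ (2 ∣ m ∧ 2 ∣ n) := fun hh => by
        have := Nat.dvd_gcd hh.1 hh.2
        rw [h] at this
        omega
      simp only [Nat.prime_two.dvd_mul]
      by_cases h1 : 2 ∣ m <;> by_cases h2 : 2 ∣ n
      · exact absurd ⟨h1, h2⟩ h12
      all_goals simp [h1, h2]
    refine (mul_le_mul hm1 hn1 (norm_nonneg _) ((norm_nonneg _).trans hm1)).trans (le_of_eq ?_)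
    rw [hW, kwG_mul a b m n h, h.card_divisors_mul]
    push_cast
    rw [Real.sqrt_mul (by positivity), Real.sqrt_mul (by positivity)]
    ring

theorem kw_convert (a b : ℤ) (c : ℕ) [NeZero c] :
    ∑ x ∈ (Finset.range c).filter (fun x => Nat.Coprime x c),
          Complex.exp (2 * (Real.pi : ℂ) * Complex.I *
            (((a * (x : ℤ) + b * ((((x : ZMod c)⁻¹).val : ℤ))) : ℤ) : ℂ) / (c : ℂ)) = kwS c a b := by
  symm
  unfold kwS
  refine Finset.sum_bij (fun u _ => (u : ZMod c).val) ?_ ?_ ?_ ?_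
  · intro u _
    rw [Finset.mem_filter, Finset.mem_range]
    exact ⟨ZMod.val_lt _, ZMod.val_coe_unit_coprime u⟩
  · intro u _ v _ h
    exact Units.ext (ZMod.val_injective c h)
  · intro x hx
    rw [Finset.mem_filter, Finset.mem_range] at hx
    refine ⟨ZMod.unitOfCoprime x hx.2, Finset.mem_univ _, ?_⟩
    rw [ZMod.coe_unitOfCoprime, ZMod.val_natCast_of_lt hx.1]
  · intro u _
    rw [← ZMod.stdAddChar_coe]
    congr 1
    push_cast
    rw [ZMod.natCast_zmod_val, ZMod.natCast_zmod_val, ZMod.inv_coe_unit]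

end Final

open Finset Complex

/-- Weil's bound for Kloosterman sums: there is an absolute constant `C` such
that for all integers `a, b` and all `c > 0`,
`|∑'_{x mod c} e^{2πi(ax + b x̄)/c}| ≤ C √c d(c) √gcd(a,b,c)`, where the sum is
over residues `x` coprime to `c` and `x̄` is the inverse of `x` mod `c`
(computed in `ZMod c`). -/
theorem kloosterman_weil_bound :
    ∃ C : ℝ, 0 < C ∧ ∀ (a b : ℤ) (c : ℕ), 0 < c →
      ‖∑ x ∈ (Finset.range c).filter (fun x => Nat.Coprime x c),
          Complex.exp (2 * (Real.pi : ℂ) * Complex.I *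
            (((a * (x : ℤ) + b * ((((x : ZMod c)⁻¹).val : ℤ))) : ℤ) : ℂ) / (c : ℂ))‖ ≤
        C * Real.sqrt c * (c.divisors.card : ℝ) * Real.sqrt (Int.gcd a (Int.gcd b (c : ℤ))) := by
  refine ⟨8, by norm_num, fun a b c hc => ?_⟩
  have : NeZero c := ⟨by omega⟩
  rw [kw_convert]
  refine (kw_all c this a b).trans ?_
  have hW : kwW c ≤ 8 := by unfold kwW; split_ifs <;> norm_num
  have : kwG a b c = Int.gcd a (Int.gcd b (c : ℤ)) := rfl
  rw [this]
  gcongr
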